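/- arXiv:math/0006137 — 3 statements merged into one kernel-verified Lean document; each statement's English description precedes it below -/
import Mathlib

section
/- Let X be a compact metric space such that every nonempty open subset of X has topological dimension at least n, and let f : X → ℝⁿ be a continuous map of bounded multiplicity. Define the stable multiplicity function μ : ℝⁿ → ℕ by letting μ(y) be the number of stable points of f in f⁻¹(y). If μ is locally maximal at y ∈ ℝⁿ (i.e., there is a neighborhood U of y with μ(y') ≤ μ(y) for all y' ∈ U), then every point of f⁻¹(y) is a stable point of f. -/
open Metric Set MeasureTheory Filter Topology

noncomputable section

/-- Cross-ratio of a four-tuple of points in a metric space. -/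
def crossRatio {Z : Type*} [MetricSpace Z] (z₁ z₂ z₃ z₄ : Z) : NNReal :=
  nndist z₁ z₃ * nndist z₂ z₄ / (nndist z₁ z₄ * nndist z₂ z₃)

/-- `f : X → Y` is `η`-quasi-Möbius. -/
def IsQuasiMobius {X Y : Type*} [MetricSpace X] [MetricSpace Y]
    (η : NNReal ≃ₜ NNReal) (f : X → Y) : Prop :=
  Function.Injective f ∧
  ∀ x₁ x₂ x₃ x₄ : X, x₁ ≠ x₂ → x₁ ≠ x₃ → x₁ ≠ x₄ → x₂ ≠ x₃ → x₂ ≠ x₄ → x₃ ≠ x₄ →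
    crossRatio (f x₁) (f x₂) (f x₃) (f x₄) ≤ η (crossRatio x₁ x₂ x₃ x₄)

/-- `f : X → Y` is `η`-quasi-symmetric. -/
def IsQuasiSymmetric {X Y : Type*} [MetricSpace X] [MetricSpace Y]
    (η : NNReal ≃ₜ NNReal) (f : X → Y) : Prop :=
  Function.Injective f ∧
  ∀ x₁ x₂ x₃ : X, x₁ ≠ x₂ → x₁ ≠ x₃ → x₂ ≠ x₃ →
    nndist (f x₁) (f x₂) / nndist (f x₁) (f x₃) ≤ η (nndist x₁ x₂ / nndist x₁ x₃)

/-- Lebesgue covering dimension is at most `n`. -/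
def covDimLE (X : Type*) [TopologicalSpace X] (n : ℕ) : Prop :=
  ∀ 𝒰 : Set (Set X), (∀ U ∈ 𝒰, IsOpen U) → ⋃₀ 𝒰 = univ →
    ∃ 𝒱 : Set (Set X), (∀ V ∈ 𝒱, IsOpen V) ∧ ⋃₀ 𝒱 = univ ∧
      (∀ V ∈ 𝒱, ∃ U ∈ 𝒰, V ⊆ U) ∧
      ∀ x : X, {V ∈ 𝒱 | x ∈ V}.encard ≤ (n + 1 : ℕ)

/-- Lebesgue covering (topological) dimension. -/
noncomputable def topDim (X : Type*) [TopologicalSpace X] : ℕ∞ :=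
  ⨅ (n : ℕ) (_ : covDimLE X n), (n : ℕ∞)

/-- Ahlfors `Q`-regularity. -/
def AhlforsRegular (Q : ℝ) (Z : Type*) [MetricSpace Z] [MeasurableSpace Z] [BorelSpace Z] :
    Prop :=
  0 < Q ∧ CompleteSpace Z ∧ 0 < Metric.diam (univ : Set Z) ∧
  ∃ C : ℝ, 1 ≤ C ∧ ∀ (z : Z) (R : ℝ), 0 < R → R ≤ Metric.diam (univ : Set Z) →
    ENNReal.ofReal (R ^ Q / C) ≤ μH[Q] (Metric.ball z R) ∧
    μH[Q] (Metric.ball z R) ≤ ENNReal.ofReal (C * R ^ Q)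

/-- The action of `G` on `Z` is by homeomorphisms, each `η`-quasi-Möbius. -/
def QMAction (η : NNReal ≃ₜ NNReal) (G Z : Type*) [Group G] [MulAction G Z]
    [MetricSpace Z] : Prop :=
  (∀ g : G, Continuous fun z : Z => g • z) ∧
  ∀ g : G, IsQuasiMobius η (fun z : Z => g • z)

/-- Cocompactness of the induced action on distinct triples (for compact `Z`). -/
def TriplesCocompact (G Z : Type*) [Group G] [MulAction G Z] [MetricSpace Z] : Prop :=
  ∃ δ > (0:ℝ), ∀ z₁ z₂ z₃ : Z, z₁ ≠ z₂ → z₁ ≠ z₃ → z₂ ≠ z₃ →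
    ∃ g : G, δ ≤ dist (g • z₁) (g • z₂) ∧ δ ≤ dist (g • z₁) (g • z₃) ∧
      δ ≤ dist (g • z₂) (g • z₃)

def IsStableValue {X Y : Type*} [TopologicalSpace X] [MetricSpace Y]
    (f : X → Y) (y : Y) : Prop :=
  ∃ ε > (0:ℝ), ∀ g : X → Y, Continuous g → (∀ x, dist (f x) (g x) < ε) → y ∈ range g

def IsStableValueOn {X Y : Type*} [TopologicalSpace X] [MetricSpace Y]
    (f : X → Y) (s : Set X) (y : Y) : Prop :=
  IsStableValue (fun x : s => f x) y

def IsStablePoint {X Y : Type*} [TopologicalSpace X] [MetricSpace Y]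
    (f : X → Y) (x : X) : Prop :=
  ∀ U ∈ nhds x, IsStableValueOn f U (f x)

/-- `f` is a regular map. -/
def IsRegularMap {X Y : Type*} [MetricSpace X] [MetricSpace Y] (f : X → Y) : Prop :=
  (∃ L : NNReal, LipschitzWith L f) ∧
  ∃ N : ℕ, ∀ (y : Y) (r : ℝ), 0 < r → ∃ t : Finset X, t.card ≤ N ∧
    f ⁻¹' Metric.ball y r ⊆ ⋃ c ∈ t, Metric.ball c r

/-- A metric space is doubling. -/
def MetricDoubling (Y : Type*) [MetricSpace Y] : Prop :=
  ∃ M : ℕ, ∀ (y : Y) (R : ℝ), ∃ t : Finset Y, t.card ≤ M ∧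
    Metric.ball y R ⊆ ⋃ c ∈ t, Metric.ball c (R / 2)

/-- A metric space is uniformly perfect. -/
def UniformlyPerfect (Z : Type*) [MetricSpace Z] : Prop :=
  ∃ lam : ℝ, 1 ≤ lam ∧ ∀ (z : Z) (R : ℝ), 0 < R → R ≤ Metric.diam (univ : Set Z) →
    (Metric.closedBall z R \ Metric.ball z (R / lam)).Nonempty

/-- `(S, q)` is a weak tangent of `Z`: `S` is complete and some rescalings
`(λ_k Z, p_k)` converge to `(S, q)` in the pointed Gromov–Hausdorff sense. -/
def PointedWeakTangent (Z : Type*) [MetricSpace Z] (S : Type*) [MetricSpace S]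
    (q : S) : Prop :=
  CompleteSpace S ∧
  ∃ (lam : ℕ → ℝ) (p : ℕ → Z), (∀ k, 0 < lam k) ∧ Tendsto lam atTop atTop ∧
    ∀ R > (0:ℝ), ∀ ε > (0:ℝ), ∃ (N : ℕ) (M : Set S),
      q ∈ M ∧ M ⊆ Metric.ball q R ∧ (∀ s ∈ Metric.ball q R, ∃ m ∈ M, dist s m ≤ ε) ∧
      ∀ k ≥ N, ∃ (Mk : Set Z) (F : Z → S),
        p k ∈ Mk ∧ (∀ z ∈ Mk, lam k * dist z (p k) < R) ∧
        (∀ z : Z, lam k * dist z (p k) < R → ∃ w ∈ Mk, lam k * dist z w ≤ ε) ∧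
        F (p k) = q ∧ Set.BijOn F Mk M ∧
        ∀ a ∈ Mk, ∀ b ∈ Mk, |lam k * dist a b - dist (F a) (F b)| < ε

/-- A point stable for the restriction of `f` to a subset is stable for `f`. -/
theorem IsStablePoint.of_restrict {X Y : Type*} [TopologicalSpace X] [MetricSpace Y]
    {f : X → Y} {s : Set X} {x : s} (h : IsStablePoint (fun q : s => f q) x) :
    IsStablePoint f x := by
  intro U hU
  obtain ⟨ε, hε, H⟩ := h _ (preimage_coe_mem_nhds_subtype.2 (mem_nhdsWithin_of_mem_nhds hU))
  refine ⟨ε, hε, fun g hg hd => ?_⟩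
  obtain ⟨q, hq⟩ := H (fun q => g ⟨q.1.1, q.2⟩) (hg.comp (by fun_prop)) (fun q => hd ⟨q.1.1, q.2⟩)
  exact ⟨_, hq⟩

theorem exists_continuousOn_ne_of_not_isStableValueOn {X Y : Type*} [TopologicalSpace X]
    [MetricSpace Y] {f : X → Y} {s t : Set X} {y : Y} (h : ¬ IsStableValueOn f s y) (hts : t ⊆ s)
    {ε : ℝ} (hε : 0 < ε) :
    ∃ g : X → Y, ContinuousOn g t ∧ ∀ q ∈ t, dist (f q) (g q) < ε ∧ g q ≠ y := by
  classical
  simp only [IsStableValueOn, IsStableValue] at h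
  push Not at h
  obtain ⟨g, hg, hd, hy⟩ := h ε hε
  refine ⟨fun q => if hq : q ∈ s then g ⟨q, hq⟩ else y, ?_, fun q hq => ?_⟩
  · rw [continuousOn_iff_continuous_domRestrict]
    have : t.domRestrict (fun q => if hq : q ∈ s then g ⟨q, hq⟩ else y)
        = fun q : t => g ⟨q.1, hts q.2⟩ := by
      ext q; exact dif_pos (hts q.2)
    rw [this]
    exact hg.comp (by fun_prop)
  · simp only [hts hq, dif_pos]
    exact ⟨hd ⟨q, hts hq⟩, fun e => hy ⟨_, e⟩⟩

/-- A family of sets that splits into `n` pairwise disjoint subfamilies has order at most `n`. -/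
theorem encard_setOf_mem_le_of_pairwiseDisjoint {X : Type*} {n : ℕ} (𝒱 : Fin n → Set (Set X))
    (h : ∀ k, (𝒱 k).PairwiseDisjoint id) (x : X) :
    {V ∈ ⋃ k, 𝒱 k | x ∈ V}.encard ≤ n := by
  have hk : ∀ V : Set X, ∃ k : Option (Fin n), V ∈ (⋃ k, 𝒱 k) → ∃ j, k = some j ∧ V ∈ 𝒱 j := by
    intro V
    by_cases hV : V ∈ ⋃ k, 𝒱 k
    · obtain ⟨j, hj⟩ := mem_iUnion.1 hV
      exact ⟨some j, fun _ => ⟨j, rfl, hj⟩⟩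
    · exact ⟨none, fun h => absurd h hV⟩
  choose c hc using hk
  have := Set.encard_le_encard_of_injOn (s := {V ∈ ⋃ k, 𝒱 k | x ∈ V})
    (t := range (some : Fin n → Option (Fin n))) (f := c) ?_ ?_
  · refine this.trans ?_
    rw [← image_univ]
    refine (encard_image_le _ _).trans ?_
    simp
  · rintro V ⟨hV, -⟩
    obtain ⟨j, hj, -⟩ := hc V hV
    exact ⟨j, hj.symm⟩
  · rintro V ⟨hV, hxV⟩ V' ⟨hV', hxV'⟩ e
    obtain ⟨j, hj, hVj⟩ := hc V hV
    obtain ⟨j', hj', hVj'⟩ := hc V' hV'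
    obtain rfl : j = j' := Option.some_injective _ (by rw [← hj, ← hj', e])
    by_contra hne
    exact disjoint_left.1 (h j hVj hVj' hne) hxV hxV'

/-- An open cover can be modified on a closed set of dimension at most `d` so that its order there
is at most `d + 1`. -/
theorem covDimLE.exists_refinement_on_isClosed {Y ι : Type*} [TopologicalSpace Y] {d : ℕ}
    {F : Set Y} (hF : IsClosed F) (hd : covDimLE F d) (u : ι → Set Y) (hu : ∀ a, IsOpen (u a))
    (hcov : ⋃ a, u a = univ) :
    ∃ w : ι → Set Y, (∀ a, IsOpen (w a)) ∧ ⋃ a, w a = univ ∧ (∀ a, w a ⊆ u a) ∧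
      (∀ a, u a \ F ⊆ w a) ∧ ∀ x ∈ F, {a | x ∈ w a}.encard ≤ (d + 1 : ℕ) := by
  obtain ⟨𝒱, hVo, hVc, hVr, hVn⟩ := hd (range fun a => ((↑) : F → Y) ⁻¹' u a)
    (by rintro _ ⟨a, rfl⟩; exact (hu a).preimage continuous_subtype_val)
    (by
      rw [sUnion_range, ← preimage_iUnion, hcov, preimage_univ])
  have hr : ∀ V : 𝒱, ∃ a, V.1 ⊆ ((↑) : F → Y) ⁻¹' u a := by
    rintro ⟨V, hV⟩
    obtain ⟨_, ⟨a, rfl⟩, ha⟩ := hVr V hV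
    exact ⟨a, ha⟩
  choose c hc using hr
  let W : ι → Set F := fun a => ⋃ V : {V : 𝒱 // c V = a}, V.1.1
  have hW : ∀ a, IsOpen (W a) := fun a => isOpen_iUnion fun V => hVo _ V.1.2
  refine ⟨fun a => u a \ ((↑) '' (W a)ᶜ), fun a => (hu a).sdiff
    (hF.isClosedEmbedding_subtypeVal.isClosedMap _ (hW a).isClosed_compl), ?_,
    fun a => sdiff_subset, ?_, ?_⟩
  · refine eq_univ_of_forall fun x => mem_iUnion.2 ?_
    by_cases hx : x ∈ F
    · obtain ⟨V, hV, hxV⟩ := mem_sUnion.1 (hVc ▸ mem_univ (⟨x, hx⟩ : F))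
      refine ⟨c ⟨V, hV⟩, hc ⟨V, hV⟩ hxV, ?_⟩
      rintro ⟨q, hq, rfl⟩
      exact hq (mem_iUnion.2 ⟨⟨⟨V, hV⟩, rfl⟩, hxV⟩)
    · obtain ⟨a, ha⟩ := mem_iUnion.1 (hcov ▸ mem_univ x)
      exact ⟨a, ha, fun ⟨q, _, e⟩ => hx (e ▸ q.2)⟩
  · rintro a x ⟨hx, hxF⟩
    exact ⟨hx, fun ⟨q, _, e⟩ => hxF (e ▸ q.2)⟩
  · intro x hx
    refine le_trans ?_ (hVn ⟨x, hx⟩)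
    have h1 : {a | x ∈ u a \ ((↑) '' (W a)ᶜ)} ⊆
        c '' {V : 𝒱 | (⟨x, hx⟩ : F) ∈ V.1} := by
      rintro a ⟨_, ha⟩
      have : (⟨x, hx⟩ : F) ∈ W a := by
        by_contra h
        exact ha ⟨_, h, rfl⟩
      obtain ⟨⟨V, rfl⟩, hV⟩ := mem_iUnion.1 this
      exact ⟨V, hV, rfl⟩
    refine (encard_le_encard h1).trans ((encard_image_le _ _).trans ?_)
    refine Set.encard_le_encard_of_injOn (f := Subtype.val) ?_ Subtype.val_injective.injOn
    exact fun V hV => ⟨V.2, hV⟩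

/-- A locally finite countable closed sum theorem for covering dimension. -/
theorem covDimLE_of_locallyFinite {Y : Type*} [TopologicalSpace Y] {d : ℕ} (F : ℕ → Set Y)
    (hF : ∀ i, IsClosed (F i)) (hcovF : ⋃ i, F i = univ)
    (hloc : ∀ x, ∃ O ∈ 𝓝 x, ∃ m, ∀ i ≥ m, Disjoint O (F i)) (hd : ∀ i, covDimLE (F i) d) :
    covDimLE Y d := by
  intro 𝒰 hUo hUc
  let C := {w : 𝒰 → Set Y // (∀ a, IsOpen (w a)) ∧ ⋃ a, w a = univ}
  have step : ∀ (i : ℕ) (w : C), ∃ w' : C, (∀ a, w'.1 a ⊆ w.1 a) ∧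
      (∀ a, w.1 a \ F i ⊆ w'.1 a) ∧ ∀ x ∈ F i, {a | x ∈ w'.1 a}.encard ≤ (d + 1 : ℕ) := by
    intro i w
    obtain ⟨w', h1, h2, h3, h4, h5⟩ :=
      (hd i).exists_refinement_on_isClosed (hF i) w.1 w.2.1 w.2.2
    exact ⟨⟨w', h1, h2⟩, h3, h4, h5⟩
  choose next hsub hdiff hcard using step
  let w : ℕ → C := fun i => Nat.rec ⟨fun a => a.1, fun a => hUo _ a.2, by
    rw [← sUnion_eq_iUnion, hUc]⟩ next i
  have hw : ∀ i, w (i + 1) = next i (w i) := fun i => rfl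
  have hanti : ∀ a, Antitone fun i => (w i).1 a := fun a =>
    antitone_nat_of_succ_le fun i => by rw [hw]; exact hsub i (w i) a
  let v : 𝒰 → Set Y := fun a => ⋂ i, (w i).1 a
  have hv : ∀ x, ∃ O ∈ 𝓝 x, ∃ m, ∀ a, O ∩ (w m).1 a ⊆ v a := by
    intro x
    obtain ⟨O, hO, m, hm⟩ := hloc x
    refine ⟨O, hO, m, fun a q hq => mem_iInter.2 fun i => ?_⟩
    rcases le_total i m with h | h
    · exact hanti a h hq.2
    · induction i, h using Nat.le_induction with
      | base => exact hq.2
      | succ i hi ih =>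
        rw [hw]
        exact hdiff i (w i) a ⟨ih, disjoint_left.1 (hm i hi) hq.1⟩
  refine ⟨range v, ?_, ?_, ?_, ?_⟩
  · rintro _ ⟨a, rfl⟩
    refine isOpen_iff_mem_nhds.2 fun x hx => ?_
    obtain ⟨O, hO, m, hm⟩ := hv x
    exact mem_of_superset (inter_mem hO (((w m).2.1 a).mem_nhds (mem_iInter.1 hx m))) (hm a)
  · refine eq_univ_of_forall fun x => ?_
    obtain ⟨O, hO, m, hm⟩ := hv x
    obtain ⟨a, ha⟩ := mem_iUnion.1 ((w m).2.2 ▸ mem_univ x)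
    exact ⟨v a, ⟨a, rfl⟩, hm a ⟨mem_of_mem_nhds hO, ha⟩⟩
  · rintro _ ⟨a, rfl⟩
    exact ⟨a.1, a.2, iInter_subset _ 0⟩
  · intro x
    obtain ⟨i, hi⟩ := mem_iUnion.1 (hcovF ▸ mem_univ x)
    refine le_trans ?_ (hcard i (w i) x hi)
    have h1 : {V ∈ range v | x ∈ V} ⊆ v '' {a | x ∈ (next i (w i)).1 a} := by
      rintro _ ⟨⟨a, rfl⟩, hx⟩
      exact ⟨a, mem_iInter.1 hx (i + 1), rfl⟩
    exact (encard_le_encard h1).trans (encard_image_le _ _)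

theorem covDimLE_of_forall_isCompact {Y : Type*} [TopologicalSpace Y] [T2Space Y]
    [WeaklyLocallyCompactSpace Y] [SigmaCompactSpace Y] {d : ℕ}
    (h : ∀ K : Set Y, IsCompact K → covDimLE K d) : covDimLE Y d := by
  let K : CompactExhaustion Y := (default : CompactExhaustion Y).shiftr
  have hc : ∀ i, IsCompact (K (i + 1) \ interior (K i)) := fun i =>
    (K.isCompact _).diff isOpen_interior
  refine covDimLE_of_locallyFinite (fun i => K (i + 1) \ interior (K i))
    (fun i => (hc i).isClosed) ?_ ?_ (fun i => h _ (hc i))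
  · refine eq_univ_of_forall fun x => mem_iUnion.2 ⟨(default : CompactExhaustion Y).find x, ?_⟩
    have := (default : CompactExhaustion Y).mem_sdiff_shiftr_find x
    exact ⟨this.1, fun hx => this.2 (interior_subset hx)⟩
  · intro x
    obtain ⟨m, hm⟩ := K.exists_mem_nhds x
    refine ⟨interior (K m), interior_mem_nhds.2 hm, m, fun i hi => ?_⟩
    exact disjoint_left.2 fun q hq hq' => hq'.2 (interior_mono (K.subset hi) hq)

theorem Set.Finite.eventually_mul_le_dist {X : Type*} [MetricSpace X] {s : Set X} (hs : s.Finite)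
    (k : ℝ) : ∀ᶠ r in 𝓝[>] (0 : ℝ), ∀ c ∈ s, ∀ c' ∈ s, c ≠ c' → k * r ≤ dist c c' := by
  refine (eventually_all_finite hs).2 fun c _ => (eventually_all_finite hs).2 fun c' _ => ?_
  by_cases h : c = c'
  · exact Eventually.of_forall fun r hne => absurd h hne
  have ht : Tendsto (fun r : ℝ => k * r) (𝓝[>] 0) (𝓝 0) :=
    ((continuous_const_mul k).tendsto' 0 0 (mul_zero k)).mono_left nhdsWithin_le_nhds
  filter_upwards [ht.eventually (gt_mem_nhds (dist_pos.2 h))] with r hr _ using hr.le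

theorem eventually_ball_mul_subset {X : Type*} [PseudoMetricSpace X] {x : X} {U : Set X}
    (hU : U ∈ 𝓝 x) (k : ℝ) : ∀ᶠ r in 𝓝[>] (0 : ℝ), ball x (k * r) ⊆ U := by
  obtain ⟨ε, hε, h⟩ := Metric.mem_nhds_iff.1 hU
  have ht : Tendsto (fun r : ℝ => k * r) (𝓝[>] 0) (𝓝 0) :=
    ((continuous_const_mul k).tendsto' 0 0 (mul_zero k)).mono_left nhdsWithin_le_nhds
  filter_upwards [ht.eventually (gt_mem_nhds hε)] with r hr
  exact (ball_subset_ball hr.le).trans h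

/-- If no point over a finite set `C` is stable, `f` can be perturbed off `C`. -/
theorem exists_continuous_forall_notMem_of_not_isStablePoint {K E : Type*} [MetricSpace K]
    [CompactSpace K] [NormedAddCommGroup E] [NormedSpace ℝ E] {f : K → E} (hf : Continuous f)
    {C : Set E} (hC : C.Finite) (hP : (f ⁻¹' C).Finite)
    (hns : ∀ p, f p ∈ C → ¬ IsStablePoint f p) {ε : ℝ} (hε : 0 < ε) :
    ∃ g : K → E, Continuous g ∧ (∀ q, dist (f q) (g q) < ε) ∧ ∀ q, g q ∉ C := by
  have hns' : ∀ p, ∃ U ∈ 𝓝 p, f p ∈ C → ¬ IsStableValueOn f U (f p) := by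
    intro p
    by_cases hp : f p ∈ C
    · have := hns p hp
      simp only [IsStablePoint] at this
      push Not at this
      obtain ⟨U, hU, h⟩ := this
      exact ⟨U, hU, fun _ => h⟩
    · exact ⟨univ, univ_mem, fun h => absurd h hp⟩
  choose U hU hUs using hns'
  obtain ⟨δ₀, hδ₀, hsep⟩ : ∃ δ > 0, ∀ c ∈ C, ∀ c' ∈ C, c ≠ c' → 2 * δ ≤ dist c c' := by
    obtain ⟨δ, h, hδ⟩ := ((hC.eventually_mul_le_dist 2).and self_mem_nhdsWithin).exists
    exact ⟨δ, hδ, h⟩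
  obtain ⟨r, hr, hrU, hrf, hrsep⟩ : ∃ r > 0, (∀ p, f p ∈ C → ball p (3 * r) ⊆ U p) ∧
      (∀ p, f p ∈ C → ∀ q ∈ ball p (3 * r), dist (f q) (f p) < δ₀) ∧
      ∀ p p', f p ∈ C → f p' ∈ C → p ≠ p' → 6 * r ≤ dist p p' := by
    have h1 : ∀ᶠ r in 𝓝[>] (0 : ℝ), ∀ p ∈ f ⁻¹' C, ball p (3 * r) ⊆ U p :=
      (eventually_all_finite hP).2 fun p _ => eventually_ball_mul_subset (hU p) 3
    have h2 : ∀ᶠ r in 𝓝[>] (0 : ℝ), ∀ p ∈ f ⁻¹' C,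
        ball p (3 * r) ⊆ f ⁻¹' ball (f p) δ₀ :=
      (eventually_all_finite hP).2 fun p _ => eventually_ball_mul_subset
        (hf.continuousAt.preimage_mem_nhds (ball_mem_nhds _ hδ₀)) 3
    obtain ⟨r, ⟨h1, h2, h3⟩, hr⟩ :=
      ((h1.and (h2.and (hP.eventually_mul_le_dist 6))).and self_mem_nhdsWithin).exists
    exact ⟨r, hr, h1, h2, fun p p' hp hp' => h3 p hp p' hp'⟩
  obtain ⟨δ, hδ, hfar⟩ : ∃ δ > 0, ∀ q, (∀ p, f p ∈ C → r ≤ dist q p) → ∀ c ∈ C,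
      δ ≤ dist (f q) c := by
    have hcl : IsClosed {q | ∀ p, f p ∈ C → r ≤ dist q p} := by
      simp only [ofPred_forall]
      exact isClosed_iInter fun p => isClosed_iInter fun _ =>
        isClosed_le continuous_const (by fun_prop)
    have h1 : ∀ c ∈ C, ∀ᶠ δ in 𝓝[>] (0 : ℝ), ∀ q ∈ {q | ∀ p, f p ∈ C → r ≤ dist q p},
        δ ≤ dist (f q) c := by
      intro c hc
      obtain ⟨a, ha, h⟩ := hcl.isCompact.exists_forall_le' (f := fun q => dist (f q) c) (a := 0)
        (by fun_prop) (fun q hq => dist_pos.2 fun e => by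
          have := hq q (e ▸ hc)
          rw [dist_self] at this
          linarith)
      filter_upwards [nhdsWithin_le_nhds (gt_mem_nhds ha)] with δ hδ q hq
      exact hδ.le.trans (h q hq)
    obtain ⟨δ, h, hδ⟩ := (((eventually_all_finite hC).2 h1).and self_mem_nhdsWithin).exists
    exact ⟨δ, hδ, fun q hq c hc => h c hc q hq⟩
  obtain ⟨η, hη, hηε, hηδ₀, hηδ⟩ : ∃ η > 0, η ≤ ε ∧ η ≤ δ₀ ∧ η ≤ δ :=
    ⟨min ε (min δ₀ δ), by positivity, min_le_left _ _,
      (min_le_right _ _).trans (min_le_left _ _), (min_le_right _ _).trans (min_le_right _ _)⟩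
  have hH : ∀ p, ∃ H : K → E, f p ∈ C → ContinuousOn H (ball p (3 * r)) ∧
      ∀ q ∈ ball p (3 * r), dist (f q) (H q) < η ∧ H q ≠ f p := by
    intro p
    by_cases hp : f p ∈ C
    · obtain ⟨H, h⟩ := exists_continuousOn_ne_of_not_isStableValueOn (hUs p hp) (hrU p hp) hη
      exact ⟨H, fun _ => h⟩
    · exact ⟨f, fun h => absurd h hp⟩
  choose H hHc hHd using hH
  let φ : K → K → ℝ := fun p q => max 0 (min 1 (2 - dist q p / r))
  have hφc : ∀ p, Continuous (φ p) := fun p => by fun_prop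
  have hφ0 : ∀ p q, 0 ≤ φ p q := fun p q => le_max_left _ _
  have hφ1 : ∀ p q, φ p q ≤ 1 := fun p q => max_le zero_le_one (min_le_left _ _)
  have hφnear : ∀ p q, dist q p ≤ r → φ p q = 1 := by
    intro p q h
    have : dist q p / r ≤ 1 := (div_le_one hr).2 h
    simp only [φ]
    rw [min_eq_left (by linarith), max_eq_right zero_le_one]
  have hφfar : ∀ p q, 2 * r ≤ dist q p → φ p q = 0 := by
    intro p q h
    have : 2 ≤ dist q p / r := (le_div_iff₀ hr).2 h
    exact max_eq_left ((min_le_right _ _).trans (by linarith))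
  let g : K → E := fun q => f q + ∑ p ∈ hP.toFinset, φ p q • (H p q - f q)
  have hgc : Continuous g := by
    refine hf.add (continuous_finsetSum _ fun p hp => ?_)
    have hp : f p ∈ C := by simpa using hp
    refine continuous_of_tsupport fun q hq => ?_
    have hq : q ∈ closedBall p (2 * r) := by
      refine (closure_minimal (fun x hx => ?_) isClosed_closedBall) hq
      by_contra hx'
      rw [mem_closedBall, not_le] at hx'
      exact hx (by simp [hφfar p x hx'.le])
    have hq' : q ∈ ball p (3 * r) := closedBall_subset_ball (by linarith) hq
    exact (hφc p).continuousAt.smul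
      (((hHc p hp).continuousAt (isOpen_ball.mem_nhds hq')).sub hf.continuousAt)
  have hgp : ∀ p q, f p ∈ C → dist q p < 2 * r → g q = f q + φ p q • (H p q - f q) := by
    intro p q hp hq
    simp only [g]
    rw [Finset.sum_eq_single_of_mem p (by simpa using hp)]
    intro p' hp' hne
    have h1 := hrsep p p' hp (by simpa using hp') hne.symm
    have h2 := dist_triangle_left p p' q
    rw [hφfar p' q (by linarith), zero_smul]
  have hg0 : ∀ q, (∀ p, f p ∈ C → 2 * r ≤ dist q p) → g q = f q := by
    intro q hq
    simp only [g]
    rw [Finset.sum_eq_zero, add_zero]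
    intro p hp
    rw [hφfar p q (hq p (by simpa using hp)), zero_smul]
  have hgd : ∀ q, dist (f q) (g q) < η := by
    intro q
    by_cases h : ∃ p, f p ∈ C ∧ dist q p < 2 * r
    · obtain ⟨p, hp, hq⟩ := h
      rw [hgp p q hp hq, dist_self_add_right, norm_smul, Real.norm_of_nonneg (hφ0 p q)]
      have h1 := (hHd p hp q (by rw [mem_ball]; linarith)).1
      rw [dist_comm, dist_eq_norm] at h1
      nlinarith [hφ1 p q, norm_nonneg (H p q - f q)]
    · push Not at h
      rw [hg0 q h, dist_self]
      exact hη
  refine ⟨g, hgc, fun q => (hgd q).trans_le hηε, fun q hq => ?_⟩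
  by_cases h : ∃ p, f p ∈ C ∧ dist q p < r
  · obtain ⟨p, hp, hqp⟩ := h
    have hb : q ∈ ball p (3 * r) := by rw [mem_ball]; linarith
    have he : g q = H p q := by
      rw [hgp p q hp (by linarith), hφnear p q hqp.le, one_smul, add_sub_cancel]
    obtain ⟨h1, h2⟩ := hHd p hp q hb
    have h3 := hsep _ hq _ hp (he ▸ h2)
    have h4 := hrf p hp q hb
    have h5 := dist_triangle_left (g q) (f p) (f q)
    have h6 := hgd q
    linarith
  · push Not at h
    have := hfar q h _ hq
    have := hgd q
    linarith

theorem exists_mem_isStablePoint_of_isStableValue {K E : Type*} [MetricSpace K]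
    [CompactSpace K] [NormedAddCommGroup E] [NormedSpace ℝ E] {f : K → E} (hf : Continuous f)
    {y : E} (hfin : (f ⁻¹' {y}).Finite) (hy : IsStableValue f y) :
    ∃ x, f x = y ∧ IsStablePoint f x := by
  by_contra! h
  obtain ⟨ε, hε, H⟩ := hy
  obtain ⟨g, hg, hd, hC⟩ := exists_continuous_forall_notMem_of_not_isStablePoint hf
    (finite_singleton y) hfin (fun p hp => h p hp) hε
  obtain ⟨q, hq⟩ := H g hg hd
  exact hC q hq

/-- The distance from a real number to the nearest half-integer. -/
def distHalfInt (t : ℝ) : ℝ := 1 / 2 - |t - round t|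

theorem continuous_distHalfInt : Continuous distHalfInt := by
  have : distHalfInt = fun t : ℝ => 1 / 2 - ‖(t : UnitAddCircle)‖ := by
    ext t
    rw [UnitAddCircle.norm_eq, distHalfInt]
  rw [this]
  exact continuous_const.sub (continuous_norm.comp (AddCircle.continuous_mk' 1))

/-- The points whose rescaled coordinates round to `m` in the directions of `S`, have floor `m` in
the others, and are farther from the half-integers in the directions of `S` than in the others.
For fixed `S.card` these sets are disjoint, and they cover all but the centers of the grid cubes. -/
def gridCell {n : ℕ} (s : ℝ) (S : Finset (Fin n)) (m : Fin n → ℤ) :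
    Set (EuclideanSpace ℝ (Fin n)) :=
  {x | (∀ i ∈ S, x i / s ∈ Ioo (m i - 1 / 2 : ℝ) (m i + 1 / 2)) ∧
    (∀ j ∉ S, x j / s ∈ Ioo (m j : ℝ) (m j + 1)) ∧
    ∀ i ∈ S, ∀ j ∉ S, distHalfInt (x j / s) < distHalfInt (x i / s)}

theorem isOpen_gridCell {n : ℕ} (s : ℝ) (S : Finset (Fin n)) (m : Fin n → ℤ) :
    IsOpen (gridCell s S m) := by
  have hc : ∀ i, Continuous fun x : EuclideanSpace ℝ (Fin n) => x i / s := fun i => by fun_prop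
  have hb : ∀ i, Continuous fun x : EuclideanSpace ℝ (Fin n) => distHalfInt (x i / s) := fun i =>
    continuous_distHalfInt.comp (hc i)
  simp only [gridCell, ofPred_and, ofPred_forall]
  refine IsOpen.inter ?_ (IsOpen.inter ?_ ?_)
  · exact isOpen_iInter_of_finite fun i => isOpen_iInter_of_finite fun _ =>
      isOpen_Ioo.preimage (hc i)
  · exact isOpen_iInter_of_finite fun i => isOpen_iInter_of_finite fun _ =>
      isOpen_Ioo.preimage (hc i)
  · exact isOpen_iInter_of_finite fun i => isOpen_iInter_of_finite fun _ =>
      isOpen_iInter_of_finite fun j => isOpen_iInter_of_finite fun _ => isOpen_lt (hb j) (hb i)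

theorem dist_le_of_mem_gridCell {n : ℕ} {s : ℝ} (hs : 0 < s) {S : Finset (Fin n)} {m : Fin n → ℤ}
    {x y : EuclideanSpace ℝ (Fin n)} (hx : x ∈ gridCell s S m) (hy : y ∈ gridCell s S m) :
    dist x y ≤ n * s := by
  have h : ∀ i, dist (x i) (y i) ≤ s := by
    intro i
    have h1 : |x i / s - y i / s| ≤ 1 := by
      by_cases hi : i ∈ S
      · have h1 := hx.1 i hi
        have h2 := hy.1 i hi
        rw [abs_le]
        constructor <;> linarith [h1.1, h1.2, h2.1, h2.2]
      · have h1 := hx.2.1 i hi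
        have h2 := hy.2.1 i hi
        rw [abs_le]
        constructor <;> linarith [h1.1, h1.2, h2.1, h2.2]
    rwa [← sub_div, abs_div, abs_of_pos hs, div_le_one hs, ← Real.dist_eq] at h1
  rw [EuclideanSpace.dist_eq]
  refine Real.sqrt_le_iff.2 ⟨by positivity, ?_⟩
  calc ∑ i, dist (x i) (y i) ^ 2 ≤ ∑ _i : Fin n, s ^ 2 :=
        Finset.sum_le_sum fun i _ => pow_le_pow_left₀ dist_nonneg (h i) 2
    _ = n * s ^ 2 := by simp
    _ ≤ (n * s) ^ 2 := by
        rw [mul_pow]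
        gcongr
        exact_mod_cast Nat.le_self_pow two_ne_zero n

theorem eq_and_eq_of_mem_gridCell {n : ℕ} {s : ℝ} {S S' : Finset (Fin n)} {m m' : Fin n → ℤ}
    (hcard : S.card = S'.card) {x : EuclideanSpace ℝ (Fin n)} (hx : x ∈ gridCell s S m)
    (hx' : x ∈ gridCell s S' m') : S = S' ∧ m = m' := by
  have hS : S = S' := by
    by_contra hne
    obtain ⟨i, hi, hi'⟩ : ∃ i ∈ S, i ∉ S' := by
      by_contra! h
      exact hne (Finset.eq_of_subset_of_card_le h hcard.ge)
    obtain ⟨j, hj, hj'⟩ : ∃ j ∈ S', j ∉ S := by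
      by_contra! h
      exact hne (Finset.eq_of_subset_of_card_le h hcard.le).symm
    exact lt_asymm (hx.2.2 i hi j hj') (hx'.2.2 j hj i hi')
  subst hS
  refine ⟨rfl, funext fun i => ?_⟩
  have key : (m i : ℝ) < m' i + 1 ∧ (m' i : ℝ) < m i + 1 := by
    by_cases hi : i ∈ S
    · have h1 := hx.1 i hi
      have h2 := hx'.1 i hi
      constructor <;> linarith [h1.1, h1.2, h2.1, h2.2]
    · have h1 := hx.2.1 i hi
      have h2 := hx'.2.1 i hi
      constructor <;> linarith [h1.1, h1.2, h2.1, h2.2]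
  have h1 : m i < m' i + 1 := by exact_mod_cast key.1
  have h2 : m' i < m i + 1 := by exact_mod_cast key.2
  omega

theorem exists_mem_gridCell {n : ℕ} [NeZero n] {s : ℝ} (hs : 0 < s)
    {x : EuclideanSpace ℝ (Fin n)} (hx : ∀ m : Fin n → ℤ, ∃ i, x i ≠ s * (m i + 1 / 2)) :
    ∃ S m, S.Nonempty ∧ x ∈ gridCell s S m := by
  classical
  let b : Fin n → ℝ := fun i => distHalfInt (x i / s)
  have hb0 : ∀ i, 0 ≤ b i := fun i => sub_nonneg.2 (abs_sub_round _)
  let S : Finset (Fin n) := {i | ∀ j, b j ≤ b i}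
  obtain ⟨i₀, hi₀⟩ := Finite.exists_max b
  have hS₀ : i₀ ∈ S := by simpa [S] using hi₀
  have hpos : 0 < b i₀ := by
    by_contra h
    have hz : ∀ i, b i = 0 := fun i => le_antisymm ((hi₀ i).trans (not_lt.1 h)) (hb0 i)
    obtain ⟨i, hi⟩ := hx fun i => ⌊x i / s⌋
    apply hi
    have h1 : |x i / s - round (x i / s)| = 1 / 2 := by
      have := hz i
      simp only [b, distHalfInt] at this
      linarith
    rw [abs_sub_round_eq_min] at h1
    have h2 : Int.fract (x i / s) = 1 / 2 := by
      rcases min_choice (Int.fract (x i / s)) (1 - Int.fract (x i / s)) with h | h <;>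
        rw [h] at h1 <;> linarith
    have h3 := Int.floor_add_fract (x i / s)
    rw [← h2, h3]
    field_simp
  have hSlt : ∀ i ∈ S, ∀ j ∉ S, b j < b i := by
    intro i hi j hj
    simp only [S, Finset.mem_filter, Finset.mem_univ, true_and, not_forall, not_le] at hi hj
    obtain ⟨k, hk⟩ := hj
    exact hk.trans_le (hi k)
  refine ⟨S, fun i => if i ∈ S then round (x i / s) else ⌊x i / s⌋, ⟨i₀, hS₀⟩, ?_, ?_, hSlt⟩
  · intro i hi
    have h1 : 0 < b i := hpos.trans_le ((Finset.mem_filter.1 hi).2 i₀)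
    have h2 := abs_lt.1 (sub_pos.1 h1)
    simp only [hi, if_true]
    constructor <;> linarith [h2.1, h2.2]
  · intro j hj
    simp only [hj, if_false]
    refine ⟨lt_of_le_of_ne (Int.floor_le _) fun e => ?_, Int.lt_floor_add_one _⟩
    have h1 := hSlt i₀ hS₀ j hj
    have h2 : b j = 1 / 2 := by
      simp only [b, distHalfInt]
      rw [← e, round_intCast, sub_self, abs_zero, sub_zero]
    have h3 : b i₀ ≤ 1 / 2 := sub_le_self _ (abs_nonneg _)
    linarith

theorem finite_gridCenters {n : ℕ} {s : ℝ} (hs : 0 < s) (R : ℝ) :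
    {c : EuclideanSpace ℝ (Fin n) | ‖c‖ ≤ R ∧ ∃ m : Fin n → ℤ, ∀ i, c i = s * (m i + 1 / 2)}.Finite
    := by
  let M : ℤ := ⌈R / s⌉ + 1
  refine ((Set.finite_Icc (fun _ : Fin n => -M) fun _ => M).image fun m =>
    (WithLp.toLp 2 fun i => s * (m i + 1 / 2 : ℝ) : EuclideanSpace ℝ (Fin n))).subset ?_
  rintro c ⟨hc, m, hm⟩
  have hM : R / s + 1 ≤ M := by
    simp only [M]
    push_cast
    linarith [Int.le_ceil (R / s)]
  have key : ∀ i, |(m i : ℝ) + 1 / 2| ≤ R / s := by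
    intro i
    rw [le_div_iff₀ hs, ← abs_of_pos hs, ← abs_mul, mul_comm, ← hm i]
    exact (PiLp.norm_apply_le c i).trans hc
  refine ⟨m, ⟨fun i => ?_, fun i => ?_⟩, ?_⟩
  · have := abs_le.1 (key i)
    have : (-M : ℝ) ≤ m i := by linarith
    exact_mod_cast this
  · have := abs_le.1 (key i)
    have : (m i : ℝ) ≤ M := by linarith
    exact_mod_cast this
  · ext i
    exact (hm i).symm

/-- Near a finite fiber, the preimages of small balls split into small disjoint open pieces. -/
theorem exists_pairwiseDisjoint_cover_preimage_ball {K E : Type*} [MetricSpace K] [CompactSpace K]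
    [MetricSpace E] {f : K → E} (hf : Continuous f) {z : E} (hz : (f ⁻¹' {z}).Finite)
    {𝒰 : Set (Set K)} (hUo : ∀ U ∈ 𝒰, IsOpen U) (hUc : ⋃₀ 𝒰 = univ) :
    ∃ r > 0, ∃ 𝒟 : Set (Set K), (∀ D ∈ 𝒟, IsOpen D) ∧ 𝒟.PairwiseDisjoint id ∧
      (∀ D ∈ 𝒟, ∃ U ∈ 𝒰, D ⊆ U) ∧ f ⁻¹' ball z r ⊆ ⋃₀ 𝒟 := by
  have hU : ∀ p, ∃ U ∈ 𝒰, p ∈ U := fun p => mem_sUnion.1 (hUc ▸ mem_univ p)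
  choose U hU𝒰 hpU using hU
  have h1 : ∀ᶠ r in 𝓝[>] (0 : ℝ), ∀ p ∈ f ⁻¹' {z}, ball p (1 * r) ⊆ U p :=
    (eventually_all_finite hz).2 fun p _ =>
      eventually_ball_mul_subset ((hUo _ (hU𝒰 p)).mem_nhds (hpU p)) 1
  obtain ⟨ρ, ⟨h1, h2⟩, hρ⟩ :=
    ((h1.and (hz.eventually_mul_le_dist 2)).and self_mem_nhdsWithin).exists
  simp only [one_mul] at h1
  have hZ : IsClosed (f '' (⋃ p ∈ f ⁻¹' {z}, ball p ρ)ᶜ) :=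
    hf.isClosedMap _ (isOpen_biUnion fun p _ => isOpen_ball).isClosed_compl
  have hzZ : z ∉ f '' (⋃ p ∈ f ⁻¹' {z}, ball p ρ)ᶜ := by
    rintro ⟨q, hq, e⟩
    exact hq (mem_biUnion (x := q) e (mem_ball_self hρ))
  obtain ⟨r, hr, hball⟩ := Metric.isOpen_iff.1 hZ.isOpen_compl z hzZ
  refine ⟨r, hr, (fun p => ball p ρ) '' (f ⁻¹' {z}), ?_, ?_, ?_, ?_⟩
  · rintro _ ⟨p, -, rfl⟩
    exact isOpen_ball
  · rintro _ ⟨p, hp, rfl⟩ _ ⟨p', hp', rfl⟩ hne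
    exact ball_disjoint_ball (by linarith [h2 p hp p' hp' (fun e => hne (by rw [e]))])
  · rintro _ ⟨p, hp, rfl⟩
    exact ⟨U p, hU𝒰 p, h1 p hp⟩
  · intro q hq
    rw [sUnion_image]
    by_contra hq'
    exact hball hq ⟨q, hq', rfl⟩

/-- A compact space with a finite-to-one map to `ℝ^(d+1)` without stable points has covering
dimension at most `d`. -/
theorem covDimLE_of_forall_not_isStablePoint {K : Type*} [MetricSpace K] [CompactSpace K] {d : ℕ}
    {f : K → EuclideanSpace ℝ (Fin (d + 1))} (hf : Continuous f)
    (hfin : ∀ z, (f ⁻¹' {z}).Finite) (hns : ∀ x, ¬ IsStablePoint f x) : covDimLE K d := by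
  intro 𝒰 hUo hUc
  choose r hr 𝒟 hDo hDd hDU hDc using fun z =>
    exists_pairwiseDisjoint_cover_preimage_ball hf (hfin z) hUo hUc
  obtain ⟨ρ, hρ, hleb⟩ := lebesgue_number_lemma_of_metric (isCompact_range hf)
    (c := fun z => ball z (r z)) (fun z => isOpen_ball)
    (fun z _ => mem_iUnion.2 ⟨z, mem_ball_self (hr z)⟩)
  obtain ⟨s, hs, hsρ⟩ : ∃ s > 0, (d + 1 : ℕ) * s < ρ / 3 :=
    ⟨ρ / 6 / (d + 1 : ℕ), by positivity, by rw [mul_div_cancel₀ _ (by positivity)]; linarith⟩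
  obtain ⟨R, hR⟩ := (isCompact_range hf).isBounded.exists_norm_le
  have hCfin := finite_gridCenters (n := d + 1) hs (R + ρ / 3)
  obtain ⟨g, hg, hgd, hgC⟩ := exists_continuous_forall_notMem_of_not_isStablePoint hf hCfin
    (hCfin.preimage' fun z _ => hfin z) (fun p _ => hns p) (ε := ρ / 3) (by positivity)
  have hgcell : ∀ q, ∃ S m, S.Nonempty ∧ g q ∈ gridCell s S m := by
    intro q
    refine exists_mem_gridCell hs fun m => ?_
    by_contra! h
    refine hgC q ⟨?_, m, h⟩
    have h1 := hgd q
    rw [dist_comm, dist_eq_norm] at h1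
    have h2 := norm_le_norm_add_norm_sub' (g q) (f q)
    have h3 := hR (f q) ⟨q, rfl⟩
    linarith
  have hpiece : ∀ S m, ∃ z, g ⁻¹' gridCell s S m ⊆ ⋃₀ 𝒟 z := by
    intro S m
    rcases (g ⁻¹' gridCell s S m).eq_empty_or_nonempty with h | ⟨q, hq⟩
    · exact ⟨0, by simp [h]⟩
    obtain ⟨z, hz⟩ := hleb (f q) ⟨q, rfl⟩
    refine ⟨z, fun q' hq' => hDc z (hz ?_)⟩
    have h1 := dist_le_of_mem_gridCell hs hq' hq
    have h2 := hgd q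
    rw [dist_comm] at h2
    have h4 := dist_triangle4 (f q') (g q') (g q) (f q)
    rw [mem_ball]
    linarith [hgd q']
  choose z hz using hpiece
  let 𝒱 : Fin (d + 1) → Set (Set K) := fun k =>
    {V | ∃ S m, S.card = k.1 + 1 ∧ ∃ D ∈ 𝒟 (z S m), V = g ⁻¹' gridCell s S m ∩ D}
  refine ⟨⋃ k, 𝒱 k, ?_, ?_, ?_, encard_setOf_mem_le_of_pairwiseDisjoint 𝒱 ?_⟩
  · intro V hV
    obtain ⟨k, S, m, -, D, hD, rfl⟩ := mem_iUnion.1 hV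
    exact ((isOpen_gridCell s S m).preimage hg).inter (hDo _ D hD)
  · refine eq_univ_of_forall fun q => ?_
    obtain ⟨S, m, hS, hq⟩ := hgcell q
    obtain ⟨D, hD, hqD⟩ := hz S m hq
    have h1 := hS.card_pos
    have h2 := S.card_le_univ
    rw [Fintype.card_fin] at h2
    exact ⟨_, mem_iUnion.2 ⟨⟨S.card - 1, by omega⟩, S, m, by simp only; omega, D, hD, rfl⟩, hq, hqD⟩
  · intro V hV
    obtain ⟨k, S, m, -, D, hD, rfl⟩ := mem_iUnion.1 hV
    obtain ⟨U, hU, hDU⟩ := hDU _ D hD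
    exact ⟨U, hU, inter_subset_right.trans hDU⟩
  · rintro k _ ⟨S, m, hS, D, hD, rfl⟩ _ ⟨S', m', hS', D', hD', rfl⟩ hne
    refine disjoint_left.2 fun q hq hq' => ?_
    obtain ⟨rfl, rfl⟩ := eq_and_eq_of_mem_gridCell (hS.trans hS'.symm) hq.1 hq'.1
    refine disjoint_left.1 (hDd _ hD hD' fun e => hne ?_) hq.2 hq'.2
    rw [e]

/-- A finite-to-one map to `ℝⁿ` has a stable point in every nonempty open set of dimension at
least `n`. -/
theorem exists_mem_isStablePoint_of_le_topDim {X : Type*} [MetricSpace X] [CompactSpace X] {n : ℕ}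
    {f : X → EuclideanSpace ℝ (Fin n)} (hf : Continuous f) (hfin : ∀ z, (f ⁻¹' {z}).Finite)
    {V : Set X} (hV : IsOpen V) (hne : V.Nonempty) (hdim : (n : ℕ∞) ≤ topDim V) :
    ∃ x ∈ V, IsStablePoint f x := by
  rcases n with - | d
  · obtain ⟨x, hx⟩ := hne
    exact ⟨x, hx, fun U hU => ⟨1, one_pos, fun g _ _ =>
      ⟨⟨x, mem_of_mem_nhds hU⟩, Subsingleton.elim _ _⟩⟩⟩
  by_contra! h
  have : LocallyCompactSpace V := hV.locallyCompactSpace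
  have hd : covDimLE V d := by
    refine covDimLE_of_forall_isCompact fun K hK => ?_
    have : CompactSpace K := isCompact_iff_compactSpace.1 hK
    refine covDimLE_of_forall_not_isStablePoint (f := fun q : K => f q.1.1) (by fun_prop)
      (fun z => ?_) fun q hq => ?_
    · have hinj : Function.Injective fun q : K => q.1.1 :=
        Subtype.val_injective.comp Subtype.val_injective
      exact Finite.preimage (f := fun q : K => q.1.1) hinj.injOn (hfin z)
    · exact h q.1.1 q.1.2
        (IsStablePoint.of_restrict (f := f) (IsStablePoint.of_restrict (f := fun v : V => f v) hq))
  have h1 : topDim V ≤ d := iInf₂_le d hd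
  have h2 := hdim.trans h1
  norm_cast at h2
  omega

/-- Stable points persist: nearby values are attained at nearby stable points. -/
theorem IsStablePoint.eventually_exists_mem {X E : Type*} [MetricSpace X] [CompactSpace X]
    [NormedAddCommGroup E] [NormedSpace ℝ E] {f : X → E} (hf : Continuous f)
    (hfin : ∀ z, (f ⁻¹' {z}).Finite) {x : X} (hx : IsStablePoint f x) {U : Set X}
    (hU : U ∈ 𝓝 x) : ∀ᶠ z in 𝓝 (f x), ∃ x' ∈ U, f x' = z ∧ IsStablePoint f x' := by
  obtain ⟨K, hK, hKU, hKc⟩ := local_compact_nhds hU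
  have : CompactSpace K := isCompact_iff_compactSpace.1 hKc
  obtain ⟨ε, hε, H⟩ := hx K hK
  filter_upwards [ball_mem_nhds (f x) (half_pos hε)] with z hz
  have hz' : IsStableValue (fun q : K => f q) z := by
    refine ⟨ε / 2, half_pos hε, fun g hg hd => ?_⟩
    obtain ⟨q, hq⟩ := H (fun q => g q + (f x - z)) (by fun_prop) fun q => by
      have h1 := hd q
      rw [mem_ball, dist_comm, dist_eq_norm] at hz
      have h2 := dist_triangle (f q) (g q) (g q + (f x - z))
      rw [dist_self_add_right] at h2
      linarith
    refine ⟨q, ?_⟩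
    have hq : g q + (f x - z) = f x := hq
    rwa [← add_sub_assoc, sub_eq_iff_eq_add, add_comm, add_right_inj] at hq
  have hfinK : ((fun q : K => f q) ⁻¹' {z}).Finite :=
    Finite.preimage (f := ((↑) : K → X)) Subtype.val_injective.injOn (hfin z)
  obtain ⟨q, hq, hqs⟩ := exists_mem_isStablePoint_of_isStableValue (by fun_prop) hfinK hz'
  exact ⟨q, hKU q.2, hq, IsStablePoint.of_restrict hqs⟩

/-- **Bonk–Kleiner, Lemma 3.8.** Let `μ(y)` be the number of stable points of `f` in
the fiber `f⁻¹(y)` (the stable multiplicity function). If `μ` is locally maximal at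
`y`, then every point of `f⁻¹(y)` is a stable point of `f`. -/
theorem fiber_all_stable_of_locally_maximal_multiplicity {X : Type*} [MetricSpace X]
    [CompactSpace X] (n : ℕ)
    (hdim : ∀ U : Set X, IsOpen U → U.Nonempty → (n : ℕ∞) ≤ topDim ↥U)
    (f : X → EuclideanSpace ℝ (Fin n)) (hf : Continuous f)
    (N : ℕ) (hmult : ∀ y, (f ⁻¹' {y}).encard ≤ N)
    (μ : EuclideanSpace ℝ (Fin n) → ℕ)
    (hμ : ∀ y, μ y = {x : X | f x = y ∧ IsStablePoint f x}.ncard)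
    (y : EuclideanSpace ℝ (Fin n))
    (hmax : ∃ W ∈ nhds y, ∀ y' ∈ W, μ y' ≤ μ y) :
    ∀ x : X, f x = y → IsStablePoint f x := by
  intro x hx
  by_contra hns
  obtain ⟨W, hW, hmax⟩ := hmax
  have hfin : ∀ z, (f ⁻¹' {z}).Finite := fun z =>
    finite_of_encard_le_coe (hmult z)
  have hSfin : ∀ z, {x : X | f x = z ∧ IsStablePoint f x}.Finite := fun z =>
    (hfin z).subset fun q hq => hq.1
  obtain ⟨r, hsep, hr⟩ :=
    (((hfin y).eventually_mul_le_dist 2).and self_mem_nhdsWithin).exists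
  have hnear : ∀ᶠ z in 𝓝 y, ∀ p ∈ {x : X | f x = y ∧ IsStablePoint f x},
      ∃ p' ∈ ball p r, f p' = z ∧ IsStablePoint f p' :=
    (eventually_all_finite (hSfin y)).2 fun p hp => by
      have := hp.2.eventually_exists_mem hf hfin (ball_mem_nhds p hr)
      rwa [hp.1] at this
  obtain ⟨O, hO, hOo, hyO⟩ := _root_.eventually_nhds_iff.1 (hnear.and (eventually_mem_set.2 hW))
  have hVo : IsOpen (ball x r ∩ f ⁻¹' O) := isOpen_ball.inter (hOo.preimage hf)
  have hVne : (ball x r ∩ f ⁻¹' O).Nonempty := ⟨x, mem_ball_self hr, by rwa [mem_preimage, hx]⟩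
  obtain ⟨x', ⟨hx'b, hx'O⟩, hx's⟩ :=
    exists_mem_isStablePoint_of_le_topDim hf hfin hVo hVne (hdim _ hVo hVne)
  obtain ⟨hlift, hfW⟩ := hO _ hx'O
  -- send each stable point over `y` to a nearby one over `f x'`, and `x` to `x'`
  have hsel : ∀ p, ∃ p', p ∈ insert x {x : X | f x = y ∧ IsStablePoint f x} →
      p' ∈ ball p r ∧ f p' = f x' ∧ IsStablePoint f p' := by
    intro p
    by_cases hp : p ∈ {x : X | f x = y ∧ IsStablePoint f x}
    · obtain ⟨p', h⟩ := hlift p hp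
      exact ⟨p', fun _ => h⟩
    · refine ⟨x', fun h => ?_⟩
      obtain rfl := h.resolve_right hp
      exact ⟨hx'b, rfl, hx's⟩
  choose c hc using hsel
  have hfib : ∀ p ∈ insert x {x : X | f x = y ∧ IsStablePoint f x}, p ∈ f ⁻¹' {y} := by
    rintro p (rfl | hp)
    · exact hx
    · exact hp.1
  have hle := ncard_le_ncard_of_injOn (s := insert x {x : X | f x = y ∧ IsStablePoint f x})
    (t := {x : X | f x = f x' ∧ IsStablePoint f x}) c (fun p hp => (hc p hp).2) ?_ (hSfin _)
  · rw [ncard_insert_of_notMem (fun h => hns h.2) (hSfin y), ← hμ, ← hμ] at hle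
    have := hmax _ hfW
    omega
  · intro p hp p' hp' e
    by_contra hne
    have h1 := (hc p hp).1
    have h2 := (hc p' hp').1
    rw [← e] at h2
    rw [mem_ball] at h1 h2
    have h3 := hsep p (hfib p hp) p' (hfib p' hp') hne
    have h4 := dist_triangle_left p p' (c p)
    linarith
end
end

section
/- Let X and Y be metric spaces and f : X → Y a Lipschitz map. Suppose X is compact and Ahlfors Q-regular for some Q > 0, Y is complete and doubling, and H^Q(f(X)) > 0, where H^Q is Q-dimensional Hausdorff measure. Then there exist weak tangents S ∈ WT(X), T ∈ WT(Y), and a regular map g : S → T. -/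
open Metric Set MeasureTheory Filter Topology

noncomputable section

/-- A pointed space with totally bounded balls which, at every resolution, maps onto large balls of
arbitrarily large rescalings of `Z` with small distortion is a weak tangent of `Z`.  The scales are
enlarged slightly so that open balls of `Z` land inside the open balls of `S` of the same radius. -/
theorem pointedWeakTangent_of_coarse_inverse {Z S : Type*} [MetricSpace Z] [MetricSpace S]
    [CompleteSpace S] {q : S} {p : Z} (htb : ∀ R : ℝ, TotallyBounded (ball q R))
    (h : ∀ R η B : ℝ, 0 < η → ∃ (l : ℝ) (ψ : S → Z), B ≤ l ∧ ψ q = p ∧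
      (∀ s ∈ ball q (R + 1), ∀ s' ∈ ball q (R + 1), |l * dist (ψ s) (ψ s') - dist s s'| < η) ∧
      ∀ z, l * dist z p < R → ∃ s ∈ ball q (R + 1), l * dist z (ψ s) < η) :
    PointedWeakTangent Z S q := by
  refine ⟨inferInstance, ?_⟩
  set δ : ℕ → ℝ := fun n => 1 / ((n : ℝ) + 1) with hδ
  have hδ0 : ∀ n, 0 < δ n := fun n => by positivity
  have hδ1 : ∀ n, δ n ≤ 1 := fun n => by
    simp only [hδ]
    rw [div_le_one (by positivity)]
    linarith [(Nat.cast_nonneg n : (0 : ℝ) ≤ n)]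
  have hδt : Tendsto δ atTop (𝓝 0) := tendsto_one_div_add_atTop_nhds_zero_nat
  have ev : ∀ (F : ℝ → ℝ) (c : ℝ), Continuous F → F 0 < c → ∀ᶠ n in atTop, F (δ n) < c :=
    fun F c hF hc => ((hF.tendsto 0).comp hδt).eventually_lt_const hc
  choose l ψ hl hψq hdist hcov using fun n : ℕ => h n (δ n ^ 2) (n + 1) (pow_pos (hδ0 n) 2)
  have hl0 : ∀ n, 0 < l n := fun n => by
    linarith [hl n, (Nat.cast_nonneg n : (0 : ℝ) ≤ n)]
  refine ⟨fun n => (1 + δ n) * l n, fun _ => p,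
    fun n => mul_pos (by linarith [hδ0 n]) (hl0 n), ?_, ?_⟩
  · refine tendsto_atTop_mono (fun n => ?_) tendsto_natCast_atTop_atTop
    nlinarith [hl n, hδ0 n, hl0 n, mul_pos (hδ0 n) (hl0 n)]
  intro R hR ε hε
  obtain ⟨M₀, hM₀, hM₀f, hM₀c⟩ :=
    Metric.finite_approx_of_totallyBounded (htb R) (ε / 4) (by positivity)
  set M : Set S := insert q M₀ with hM
  have hMf : M.Finite := hM₀f.insert q
  have hMR : M ⊆ ball q R := insert_subset (mem_ball_self hR) hM₀
  have hqM : q ∈ M := mem_insert q M₀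
  have hMd : ∀ s ∈ ball q R, ∃ m ∈ M, dist s m < ε / 4 := fun s hs => by
    obtain ⟨m, hm, hsm⟩ := mem_iUnion₂.1 (hM₀c hs)
    exact ⟨m, mem_insert_of_mem _ hm, hsm⟩
  have e1 : ∀ᶠ n in atTop, ∀ m ∈ M, (1 + δ n) * (dist m q + δ n ^ 2) < R :=
    (hMf.eventually_all).2 fun m hm =>
      ev (fun t => (1 + t) * (dist m q + t ^ 2)) R (by fun_prop) (by simpa using hMR hm)
  have e2 : ∀ᶠ n in atTop, ∀ m ∈ M, ∀ m' ∈ M, m ≠ m' → δ n ^ 2 < dist m m' :=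
    (hMf.eventually_all).2 fun m hm => (hMf.eventually_all).2 fun m' hm' => by
      by_cases hmm : m = m'
      · simp [hmm]
      · filter_upwards [ev (fun t => t ^ 2) (dist m m') (by fun_prop) (by simpa using hmm)]
          with n hn _ using hn
  have e3 := ev (fun t => t * (2 * R + t ^ 2) + t ^ 2) ε (by fun_prop) (by simpa using hε)
  have e4 := ev (fun t => 4 * t) R (by fun_prop) (by simpa using hR)
  have e5 := ev (fun t => 8 * t ^ 2) ε (by fun_prop) (by simpa using hε)
  have e6 : ∀ᶠ n : ℕ in atTop, R ≤ n := tendsto_natCast_atTop_atTop.eventually_ge_atTop R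
  obtain ⟨N, hN⟩ := eventually_atTop.1 (e1.and (e2.and (e3.and (e4.and (e5.and e6)))))
  refine ⟨N, M, hqM, hMR, fun s hs => ?_, fun n hn => ?_⟩
  · obtain ⟨m, hm, hsm⟩ := hMd s hs
    exact ⟨m, hm, by linarith⟩
  obtain ⟨h1, h2, h3, h4, h5, h6⟩ := hN n hn
  have hd0 := hδ0 n
  have hd1 := hδ1 n
  have hln := hl0 n
  have hbig : ball q R ⊆ ball q ((n : ℝ) + 1) := ball_subset_ball (by linarith)
  have hdM : ∀ s ∈ ball q R, ∀ s' ∈ ball q R,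
      |l n * dist (ψ n s) (ψ n s') - dist s s'| < δ n ^ 2 :=
    fun s hs s' hs' => hdist n s (hbig hs) s' (hbig hs')
  have hinj : InjOn (ψ n) M := by
    intro m hm m' hm' he
    by_contra hne
    have := hdM m (hMR hm) m' (hMR hm')
    rw [he, dist_self, mul_zero, zero_sub, abs_neg, abs_of_nonneg dist_nonneg] at this
    linarith [h2 m hm m' hm' hne]
  have : Nonempty S := ⟨q⟩
  have hinv : ∀ m ∈ M, Function.invFunOn (ψ n) M (ψ n m) = m := fun m hm =>
    hinj.leftInvOn_invFunOn hm
  refine ⟨ψ n '' M, Function.invFunOn (ψ n) M, ⟨q, hqM, hψq n⟩, ?_, ?_, ?_, ?_, ?_⟩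
  · rintro _ ⟨m, hm, rfl⟩
    have := (abs_lt.1 (hdM m (hMR hm) q (mem_ball_self hR))).2
    rw [hψq] at this
    calc (1 + δ n) * l n * dist (ψ n m) p = (1 + δ n) * (l n * dist (ψ n m) p) := by ring
      _ ≤ (1 + δ n) * (dist m q + δ n ^ 2) := by gcongr; linarith
      _ < R := h1 m hm
  · intro z hz
    have hz0 : 0 ≤ l n * dist z p := by positivity
    obtain ⟨s, hs, hzs⟩ := hcov n z (by nlinarith [mul_nonneg hd0.le hz0])
    have hsq := (abs_lt.1 (hdist n s hs q (mem_ball_self (by positivity)))).1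
    rw [hψq] at hsq
    have htri : l n * dist (ψ n s) p ≤ l n * dist z (ψ n s) + l n * dist z p := by
      rw [← mul_add, dist_comm z (ψ n s)]
      exact mul_le_mul_of_nonneg_left (dist_triangle _ _ _) hln.le
    have hsR : dist s q < R := by
      have ha : (1 + δ n) * dist s q < (1 + δ n) * (l n * dist z p + 2 * δ n ^ 2) := by
        apply mul_lt_mul_of_pos_left _ (by linarith)
        linarith
      have hb : (1 + δ n) * (2 * δ n ^ 2) ≤ δ n * R := by
        nlinarith [mul_nonneg hd0.le (sub_nonneg.2 hd1), mul_pos hd0 hd0,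
          mul_lt_mul_of_pos_left h4 hd0, mul_nonneg (mul_pos hd0 hd0).le (sub_nonneg.2 hd1)]
      nlinarith
    obtain ⟨m, hm, hsm⟩ := hMd s hsR
    refine ⟨ψ n m, ⟨m, hm, rfl⟩, ?_⟩
    have hsm' := (abs_lt.1 (hdM s hsR m (hMR hm))).2
    have htri' : l n * dist z (ψ n m) ≤ l n * dist z (ψ n s) + l n * dist (ψ n s) (ψ n m) := by
      rw [← mul_add]
      exact mul_le_mul_of_nonneg_left (dist_triangle _ _ _) hln.le
    calc (1 + δ n) * l n * dist z (ψ n m) = (1 + δ n) * (l n * dist z (ψ n m)) := by ring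
      _ ≤ 2 * (ε / 4 + 2 * δ n ^ 2) := by
        apply mul_le_mul (by linarith) (by linarith) (by positivity) (by norm_num)
      _ ≤ ε := by linarith
  · rw [← hψq n]
    exact hinv q hqM
  · refine ⟨?_, ?_, ?_⟩
    · rintro _ ⟨m, hm, rfl⟩
      rwa [hinv m hm]
    · rintro _ ⟨m, hm, rfl⟩ _ ⟨m', hm', rfl⟩ he
      rw [hinv m hm, hinv m' hm'] at he
      rw [he]
    · exact fun m hm => ⟨ψ n m, ⟨m, hm, rfl⟩, hinv m hm⟩
  · rintro _ ⟨m, hm, rfl⟩ _ ⟨m', hm', rfl⟩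
    rw [hinv m hm, hinv m' hm']
    have hmm := abs_lt.1 (hdM m (hMR hm) m' (hMR hm'))
    have hd2 : dist m m' ≤ 2 * R := by
      have := dist_triangle_right m m' q
      linarith [mem_ball.1 (hMR hm), mem_ball.1 (hMR hm')]
    have hlow : 0 ≤ δ n * (l n * dist (ψ n m) (ψ n m')) := by positivity
    have hup : δ n * (l n * dist (ψ n m) (ψ n m')) ≤ δ n * (2 * R + δ n ^ 2) :=
      mul_le_mul_of_nonneg_left (by linarith) hd0.le
    rw [abs_lt]
    constructor <;> nlinarith

/-- The distance of `Z` rescaled by the factor `k + 1`. -/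
def blowupDist {Z : Type*} [MetricSpace Z] (k : ℕ) (x y : Z) : ℝ := ((k : ℝ) + 1) * dist x y

section blowupDist

variable {Z : Type*} [MetricSpace Z] (k : ℕ) (x y z : Z)

theorem blowupDist_self : blowupDist k x x = 0 := by simp [blowupDist]

theorem blowupDist_comm : blowupDist k x y = blowupDist k y x := by
  simp [blowupDist, dist_comm]

theorem blowupDist_nonneg : 0 ≤ blowupDist k x y := by
  unfold blowupDist
  positivity

theorem blowupDist_triangle : blowupDist k x z ≤ blowupDist k x y + blowupDist k y z := by
  unfold blowupDist
  rw [← mul_add]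
  exact mul_le_mul_of_nonneg_left (dist_triangle x y z) (by positivity)

variable {k x y} in
theorem blowupDist_lt_iff {r : ℝ} : blowupDist k x y < r ↔ dist x y < r / ((k : ℝ) + 1) := by
  rw [blowupDist, lt_div_iff₀' (by positivity)]

variable {k x y} in
theorem blowupDist_le_iff {r : ℝ} : blowupDist k x y ≤ r ↔ dist x y ≤ r / ((k : ℝ) + 1) := by
  rw [blowupDist, le_div_iff₀' (by positivity)]

theorem LipschitzWith.blowupDist_le {W : Type*} [MetricSpace W] {f : Z → W} {L : NNReal}
    (hf : LipschitzWith L f) : blowupDist k (f x) (f y) ≤ L * blowupDist k x y := by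
  unfold blowupDist
  calc ((k : ℝ) + 1) * dist (f x) (f y) ≤ ((k : ℝ) + 1) * (L * dist x y) :=
        mul_le_mul_of_nonneg_left (hf.dist_le_mul x y) (by positivity)
    _ = L * (((k : ℝ) + 1) * dist x y) := by ring

end blowupDist

/-- Sequences staying at bounded distance from `p` in the blow-ups of `Z` at `p`. -/
def BlowupSeq {Z : Type*} [MetricSpace Z] (p : Z) : Type _ :=
  {x : ℕ → Z // ∃ B, ∀ k, blowupDist k (x k) p ≤ B}

/-- The blow-ups of `Z` at `p` are eventually uniformly totally bounded. -/
def BlowupTotallyBounded {Z : Type*} [MetricSpace Z] (p : Z) : Prop :=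
  ∀ R ε : ℝ, 0 < R → 0 < ε → ∃ N : ℕ, ∀ᶠ k : ℕ in atTop, ∃ t : Finset Z, t.card ≤ N ∧
    ball p (R / ((k : ℝ) + 1)) ⊆ ⋃ c ∈ t, ball c (ε / ((k : ℝ) + 1))

namespace BlowupSeq

variable {Z : Type*} [MetricSpace Z] {p : Z}

/-- The constant sequence at the base point. -/
def base (p : Z) : BlowupSeq p := ⟨fun _ => p, 0, fun k => (blowupDist_self k p).le⟩

/-- The sequence `x` with every term at rescaled distance more than `B` from `p` reset to `p`. -/
def truncate (p : Z) (B : ℝ) (x : ℕ → Z) : BlowupSeq p :=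
  ⟨fun k => open Classical in if blowupDist k (x k) p ≤ B then x k else p, max B 0, fun k => by
    dsimp only
    split_ifs with h
    · exact h.trans (le_max_left _ _)
    · rw [blowupDist_self]
      exact le_max_right _ _⟩

theorem truncate_apply {B : ℝ} {x : ℕ → Z} {k : ℕ} (h : blowupDist k (x k) p ≤ B) :
    (truncate p B x).1 k = x k := if_pos h

theorem exists_tendsto (x y : BlowupSeq p) :
    ∃ l : ℝ, Tendsto (fun k => blowupDist k (x.1 k) (y.1 k)) (hyperfilter ℕ) (𝓝 l) := by
  obtain ⟨B, hB⟩ := x.2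
  obtain ⟨B', hB'⟩ := y.2
  have hmem : ∀ k, blowupDist k (x.1 k) (y.1 k) ∈ Icc 0 (B + B') := fun k =>
    ⟨blowupDist_nonneg _ _ _, (blowupDist_triangle k (x.1 k) p (y.1 k)).trans
      (add_le_add (hB k) (by rw [blowupDist_comm]; exact hB' k))⟩
  obtain ⟨l, -, hl⟩ := (isCompact_Icc (a := (0 : ℝ)) (b := B + B')).ultrafilter_le_nhds
    ((hyperfilter ℕ).map fun k => blowupDist k (x.1 k) (y.1 k))
    (by
      rw [le_principal_iff, Ultrafilter.mem_coe, Ultrafilter.mem_map]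
      exact univ_mem' hmem)
  exact ⟨l, hl⟩

instance : Dist (BlowupSeq p) :=
  ⟨fun x y => limUnder (hyperfilter ℕ : Filter ℕ) fun k => blowupDist k (x.1 k) (y.1 k)⟩

theorem tendsto_dist (x y : BlowupSeq p) :
    Tendsto (fun k => blowupDist k (x.1 k) (y.1 k)) (hyperfilter ℕ) (𝓝 (dist x y)) :=
  tendsto_nhds_limUnder (exists_tendsto x y)

instance : PseudoMetricSpace (BlowupSeq p) where
  dist_self x := tendsto_nhds_unique (tendsto_dist x x) (by simp [blowupDist_self])
  dist_comm x y := tendsto_nhds_unique (tendsto_dist x y) (by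
    simpa only [blowupDist_comm] using tendsto_dist y x)
  dist_triangle x y z := le_of_tendsto_of_tendsto' (tendsto_dist x z)
    ((tendsto_dist x y).add (tendsto_dist y z)) fun k => blowupDist_triangle k _ _ _

theorem exists_finite_net (hp : BlowupTotallyBounded p) {R ε : ℝ} (hR : 0 < R) (hε : 0 < ε) :
    ∃ F : Set (BlowupSeq p), F.Finite ∧ ∀ x, dist x (base p) < R → ∃ c ∈ F, dist x c < ε := by
  obtain ⟨N, hN⟩ := hp R (ε / 2) hR (by positivity)
  have henum : ∀ k : ℕ, ∃ e : Fin N → Z, (∃ t : Finset Z, t.card ≤ N ∧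
      ball p (R / ((k : ℝ) + 1)) ⊆ ⋃ c ∈ t, ball c (ε / 2 / ((k : ℝ) + 1))) →
      ∀ z, blowupDist k z p < R → ∃ j, blowupDist k z (e j) < ε / 2 := by
    intro k
    by_cases ht : ∃ t : Finset Z, t.card ≤ N ∧
      ball p (R / ((k : ℝ) + 1)) ⊆ ⋃ c ∈ t, ball c (ε / 2 / ((k : ℝ) + 1))
    · obtain ⟨t, htN, htc⟩ := ht
      refine ⟨fun j => t.toList.getD j p, fun _ z hz => ?_⟩
      obtain ⟨c, hc, hzc⟩ := mem_iUnion₂.1 (htc (blowupDist_lt_iff.1 hz))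
      obtain ⟨i, hi, rfl⟩ := List.mem_iff_getElem.1 (Finset.mem_toList.2 hc)
      refine ⟨⟨i, by rw [Finset.length_toList] at hi; omega⟩, ?_⟩
      dsimp only
      rw [List.getD_eq_getElem _ _ hi]
      exact blowupDist_lt_iff.2 hzc
    · exact ⟨fun _ => p, fun h => absurd h ht⟩
  choose e he using henum
  refine ⟨range fun j => truncate p (R + ε / 2) fun k => e k j, finite_range _, fun x hx => ?_⟩
  have hev : ∀ᶠ k in (hyperfilter ℕ : Filter ℕ), ∃ j,
      blowupDist k (x.1 k) ((truncate p (R + ε / 2) fun k => e k j).1 k) < ε / 2 := by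
    filter_upwards [Nat.hyperfilter_le_atTop hN, (tendsto_dist x (base p)).eventually_lt_const hx]
      with k hk hxk
    obtain ⟨j, hj⟩ := he k hk _ hxk
    refine ⟨j, ?_⟩
    rw [truncate_apply]
    · exact hj
    · have h1 := blowupDist_triangle k (e k j) (x.1 k) p
      rw [blowupDist_comm k (e k j) (x.1 k)] at h1
      have h2 : blowupDist k (x.1 k) p < R := hxk
      linarith
  obtain ⟨j, hj⟩ := Ultrafilter.eventually_exists_iff.1 hev
  refine ⟨_, ⟨j, rfl⟩, ?_⟩
  have := le_of_tendsto (tendsto_dist x _) (hj.mono fun _ h => h.le)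
  linarith

theorem separableSpace (hp : BlowupTotallyBounded p) :
    TopologicalSpace.SeparableSpace (BlowupSeq p) := by
  choose F hF hFd using fun ij : ℕ × ℕ =>
    exists_finite_net hp (R := (ij.1 : ℝ) + 1) (ε := 1 / ((ij.2 : ℝ) + 1)) (by positivity)
      (by positivity)
  refine ⟨⋃ ij, F ij, countable_iUnion fun ij => (hF ij).countable, ?_⟩
  rw [Metric.dense_iff]
  intro x r hr
  obtain ⟨i, hi⟩ := exists_nat_gt (dist x (base p))
  obtain ⟨j, hj⟩ := exists_nat_one_div_lt hr
  obtain ⟨c, hc, hxc⟩ := hFd (i, j) x (by simp only; linarith)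
  refine ⟨c, ?_, mem_iUnion.2 ⟨_, hc⟩⟩
  rw [mem_ball, dist_comm]
  exact hxc.trans hj

/-- A finite net of the ultralimit is realised in almost all blow-ups. -/
theorem eventually_forall_exists_mem {F : Set (BlowupSeq p)} {R ε : ℝ}
    (hF : ∀ x, dist x (base p) ≤ R → ∃ c ∈ F, dist x c < ε) :
    ∀ᶠ k in (hyperfilter ℕ : Filter ℕ), ∀ z, blowupDist k z p < R →
      ∃ c ∈ F, blowupDist k z (c.1 k) < ε := by
  by_contra hcon
  rw [← Ultrafilter.eventually_not] at hcon
  have hbad : ∀ k : ℕ, ∃ z, (¬ ∀ z, blowupDist k z p < R → ∃ c ∈ F, blowupDist k z (c.1 k) < ε) →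
      blowupDist k z p < R ∧ ∀ c ∈ F, ε ≤ blowupDist k z (c.1 k) := by
    intro k
    by_cases h : ∀ z, blowupDist k z p < R → ∃ c ∈ F, blowupDist k z (c.1 k) < ε
    · exact ⟨p, fun h' => absurd h h'⟩
    · have h' := h
      push Not at h
      obtain ⟨z, hz⟩ := h
      exact ⟨z, fun _ => hz⟩
  choose z hz using hbad
  set x := truncate p R z
  have hx : ∀ᶠ k in (hyperfilter ℕ : Filter ℕ),
      x.1 k = z k ∧ blowupDist k (z k) p < R ∧ ∀ c ∈ F, ε ≤ blowupDist k (z k) (c.1 k) := by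
    filter_upwards [hcon] with k hk
    exact ⟨truncate_apply (hz k hk).1.le, hz k hk⟩
  obtain ⟨c, hc, hxc⟩ := hF x (le_of_tendsto (tendsto_dist x (base p)) (by
    filter_upwards [hx] with k hk
    rw [hk.1]
    exact hk.2.1.le))
  have : ε ≤ dist x c := ge_of_tendsto (tendsto_dist x c) (by
    filter_upwards [hx] with k hk
    rw [hk.1]
    exact hk.2.2 c hc)
  linarith

/-- A complete space containing the ultralimit of the blow-ups densely is a weak tangent. -/
theorem pointedWeakTangent (hp : BlowupTotallyBounded p) {S : Type*} [MetricSpace S]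
    [CompleteSpace S] {st : BlowupSeq p → S} (hst : Isometry st) (hd : DenseRange st) :
    PointedWeakTangent Z S (st (base p)) := by
  set q := st (base p) with hq
  have hnet : ∀ R ε : ℝ, 0 < R → 0 < ε → ∃ F : Set (BlowupSeq p), F.Finite ∧
      ∀ s, dist s q < R → ∃ c ∈ F, dist s (st c) < ε := by
    intro R ε hR hε
    obtain ⟨F, hF, hFc⟩ := exists_finite_net hp hR (half_pos hε)
    refine ⟨F, hF, fun s hs => ?_⟩
    obtain ⟨x, hx⟩ := hd.exists_dist_lt s (lt_min (half_pos hε) (sub_pos.2 hs))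
    obtain ⟨c, hc, hxc⟩ := hFc x (by
      rw [← hst.dist_eq]
      have := dist_triangle_left (st x) q s
      linarith [hx.trans_le (min_le_right _ _)])
    refine ⟨c, hc, ?_⟩
    rw [← hst.dist_eq] at hxc
    have := dist_triangle s (st x) (st c)
    linarith [hx.trans_le (min_le_left _ _)]
  refine pointedWeakTangent_of_coarse_inverse (p := p) (fun R => ?_) fun R η B hη => ?_
  · refine Metric.totallyBounded_iff.2 fun ε hε => ?_
    obtain ⟨F, hF, hFc⟩ := hnet (max R 1) ε (by positivity) hε
    refine ⟨st '' F, hF.image st, fun s hs => ?_⟩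
    obtain ⟨c, hc, hsc⟩ := hFc s (lt_of_lt_of_le hs (le_max_left _ _))
    exact mem_iUnion₂.2 ⟨st c, mem_image_of_mem st hc, hsc⟩
  set θ := min η 1 / 8 with hθ
  have hθ0 : 0 < θ := by positivity
  have hθη : 8 * θ ≤ η := by linarith [min_le_left η 1]
  have hθ1 : 8 * θ ≤ 1 := by linarith [min_le_right η 1]
  obtain ⟨F, hF, hFc⟩ := hnet (|R| + 3) θ (by positivity) hθ0
  have hR : R ≤ |R| := le_abs_self R
  have hchoice : ∀ s, ∃ c : BlowupSeq p, (s = q → c = base p) ∧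
      (dist s q < |R| + 3 → c ∈ insert (base p) F ∧ dist s (st c) < θ) := by
    intro s
    by_cases hsq : s = q
    · exact ⟨base p, fun _ => rfl, fun _ => ⟨mem_insert _ _, by rw [hsq, hq, dist_self]; exact hθ0⟩⟩
    by_cases hs : dist s q < |R| + 3
    · obtain ⟨c, hc, hsc⟩ := hFc s hs
      exact ⟨c, fun h => absurd h hsq, fun _ => ⟨mem_insert_of_mem _ hc, hsc⟩⟩
    · exact ⟨base p, fun _ => rfl, fun h => absurd h hs⟩
  choose c hcq hc using hchoice
  have hF' := hF.insert (base p)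
  have ev1 : ∀ᶠ k in (hyperfilter ℕ : Filter ℕ), ∀ a ∈ insert (base p) F,
      ∀ b ∈ insert (base p) F, |blowupDist k (a.1 k) (b.1 k) - dist a b| < θ :=
    hF'.eventually_all.2 fun a _ => hF'.eventually_all.2 fun b _ => by
      simpa only [Real.dist_eq] using (Metric.tendsto_nhds.1 (tendsto_dist a b)) θ hθ0
  have ev2 : ∀ᶠ k in (hyperfilter ℕ : Filter ℕ), ∀ z, blowupDist k z p < R →
      ∃ c ∈ F, blowupDist k z (c.1 k) < θ :=
    eventually_forall_exists_mem fun x hx => by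
      obtain ⟨c, hc, hxc⟩ := hFc (st x) (by rw [hst.dist_eq]; linarith)
      exact ⟨c, hc, by rwa [hst.dist_eq] at hxc⟩
  have ev3 : ∀ᶠ k : ℕ in (hyperfilter ℕ : Filter ℕ), B ≤ k :=
    Nat.hyperfilter_le_atTop (tendsto_natCast_atTop_atTop.eventually_ge_atTop B)
  obtain ⟨k, h1, h2, h3⟩ := (ev1.and (ev2.and ev3)).exists
  refine ⟨(k : ℝ) + 1, fun s => (c s).1 k, by linarith, ?_, fun s hs s' hs' => ?_, fun z hz => ?_⟩
  · simp only [hcq q rfl]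
    rfl
  · obtain ⟨hs1, hs2⟩ := hc s (by linarith [mem_ball.1 hs])
    obtain ⟨hs1', hs2'⟩ := hc s' (by linarith [mem_ball.1 hs'])
    have hd1 := abs_lt.1 (h1 _ hs1 _ hs1')
    have hd2 := dist_dist_dist_le s s' (st (c s)) (st (c s'))
    rw [hst.dist_eq, Real.dist_eq, abs_le] at hd2
    change |blowupDist k ((c s).1 k) ((c s').1 k) - _| < η
    rw [abs_lt]
    constructor <;> linarith
  · obtain ⟨a, ha, hza⟩ := h2 z hz
    have hab := (abs_lt.1 (h1 a (mem_insert_of_mem _ ha) _ (mem_insert _ _))).1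
    have haz := blowupDist_triangle k (a.1 k) z p
    rw [blowupDist_comm k (a.1 k) z] at haz
    have hz' : blowupDist k z p < R := hz
    have haq : dist (st a) q < R + 1 := by
      rw [hst.dist_eq]
      change -θ < blowupDist k (a.1 k) p - dist a (base p) at hab
      linarith
    refine ⟨st a, haq, ?_⟩
    obtain ⟨hs1, hs2⟩ := hc (st a) (by linarith)
    rw [hst.dist_eq] at hs2
    have had := (abs_lt.1 (h1 a (mem_insert_of_mem _ ha) _ hs1)).2
    have := blowupDist_triangle k z (a.1 k) ((c (st a)).1 k)
    change blowupDist k z ((c (st a)).1 k) < η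
    linarith

/-- If the blow-ups of `Z` at `p` are uniformly totally bounded, their ultralimit embeds densely and
isometrically into a weak tangent of `Z` lying in `Type`. -/
theorem exists_pointedWeakTangent (hp : BlowupTotallyBounded p) :
    ∃ (S : Type) (_ : MetricSpace S) (st : BlowupSeq p → S), Isometry st ∧ DenseRange st ∧
      PointedWeakTangent Z S (st (base p)) := by
  have := separableSpace hp
  have : TopologicalSpace.SeparableSpace (SeparationQuotient (BlowupSeq p)) :=
    SeparationQuotient.surjective_mk.denseRange.separableSpace SeparationQuotient.continuous_mk
  obtain ⟨e, he⟩ := KuratowskiEmbedding.exists_isometric_embedding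
    (SeparationQuotient (BlowupSeq p))
  set j := fun x : BlowupSeq p => e (SeparationQuotient.mk x)
  have hj : Isometry j := Isometry.of_dist_eq fun x y => by
    rw [he.dist_eq, SeparationQuotient.dist_mk]
  set st : BlowupSeq p → closure (range j) := fun x => ⟨j x, subset_closure (mem_range_self x)⟩
  have hst : Isometry st := hj
  have hd : DenseRange st := by
    rw [DenseRange, Subtype.dense_iff, ← range_comp]
    exact subset_rfl
  have : CompleteSpace (closure (range j)) := isClosed_closure.completeSpace_coe
  exact ⟨closure (range j), inferInstance, st, hst, hd, pointedWeakTangent hp hst hd⟩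

end BlowupSeq

theorem exists_finset_cover_of_separated_card_le {Z : Type*} [PseudoMetricSpace Z] {A : Set Z}
    {r : ℝ} (hr : 0 < r) {N : ℕ}
    (h : ∀ t : Finset Z, (t : Set Z) ⊆ A → (t : Set Z).Pairwise (fun x y => r ≤ dist x y) →
      t.card ≤ N) :
    ∃ t : Finset Z, t.card ≤ N ∧ A ⊆ ⋃ c ∈ t, ball c r := by
  classical
  let P : ℕ → Prop := fun n => ∃ t : Finset Z, (t : Set Z) ⊆ A ∧
    (t : Set Z).Pairwise (fun x y => r ≤ dist x y) ∧ t.card = n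
  have h0 : P 0 := ⟨∅, by simp, by simp, rfl⟩
  obtain ⟨t, htA, htr, htc⟩ := Nat.findGreatest_spec (P := P) (Nat.zero_le N) h0
  refine ⟨t, h t htA htr, fun z hz => ?_⟩
  by_contra hcov
  simp only [mem_iUnion, mem_ball, not_exists, not_lt] at hcov
  have hzt : z ∉ t := fun hzt => by
    have := hcov z hzt
    rw [dist_self] at this
    linarith
  have hA : ((insert z t : Finset Z) : Set Z) ⊆ A := by
    rw [Finset.coe_insert]
    exact insert_subset hz htA
  have hsep : ((insert z t : Finset Z) : Set Z).Pairwise (fun x y => r ≤ dist x y) := by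
    rw [Finset.coe_insert]
    exact htr.insert fun c hc _ => ⟨hcov c hc, by rw [dist_comm]; exact hcov c hc⟩
  have hcard := Finset.card_insert_of_notMem hzt
  have := Nat.le_findGreatest (P := P) (h _ hA hsep) ⟨_, hA, hsep, rfl⟩
  omega

theorem card_le_div_of_separated {X : Type*} [PseudoMetricSpace X] [MeasurableSpace X]
    [OpensMeasurableSpace X] {μ : Measure X} {t : Finset X} {U : Set X} {s a b : ℝ}
    (hsep : (t : Set X).Pairwise fun x y => s + s ≤ dist x y) (hU : ∀ x ∈ t, ball x s ⊆ U)
    (ha : 0 < a) (hb : 0 ≤ b) (hlow : ∀ x ∈ t, ENNReal.ofReal a ≤ μ (ball x s))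
    (hup : μ U ≤ ENNReal.ofReal b) : (t.card : ℝ) ≤ b / a := by
  have hdisj : (t : Set X).PairwiseDisjoint fun x => ball x s :=
    fun x hx y hy hxy => ball_disjoint_ball (hsep hx hy hxy)
  have hle : ENNReal.ofReal (t.card * a) ≤ ENNReal.ofReal b :=
    calc ENNReal.ofReal (t.card * a) = ∑ _x ∈ t, ENNReal.ofReal a := by
          rw [Finset.sum_const, nsmul_eq_mul, ENNReal.ofReal_mul (by positivity),
            ENNReal.ofReal_natCast]
      _ ≤ ∑ x ∈ t, μ (ball x s) := Finset.sum_le_sum hlow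
      _ = μ (⋃ x ∈ t, ball x s) :=
          (measure_biUnion_finset hdisj fun _ _ => measurableSet_ball).symm
      _ ≤ μ U := measure_mono (iUnion₂_subset hU)
      _ ≤ ENNReal.ofReal b := hup
  rw [le_div_iff₀ ha]
  exact (ENNReal.ofReal_le_ofReal_iff hb).1 hle

/-- A finite measure has finite upper `Q`-density away from a set of zero `Q`-dimensional Hausdorff
measure. -/
theorem hausdorffMeasure_setOf_unbounded_density {Y : Type*} [MetricSpace Y] [MeasurableSpace Y]
    [BorelSpace Y] (ν : Measure Y) [IsFiniteMeasure ν] {Q : ℝ} (hQ : 0 < Q) :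
    μH[Q] {y : Y | ∀ n : ℕ, ∃ r, 0 < r ∧ r < 1 / ((n : ℝ) + 1) ∧
      ENNReal.ofReal ((n + 1) * r ^ Q) < ν (ball y r)} = 0 := by
  set D := {y : Y | ∀ n : ℕ, ∃ r, 0 < r ∧ r < 1 / ((n : ℝ) + 1) ∧
      ENNReal.ofReal ((n + 1) * r ^ Q) < ν (ball y r)} with hD
  have hchoice : ∀ (n : ℕ) (y : Y), ∃ r, y ∈ D → 0 < r ∧ r < 1 / ((n : ℝ) + 1) ∧
      ENNReal.ofReal ((n + 1) * r ^ Q) < ν (ball y r) := fun n y => by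
    by_cases hy : y ∈ D
    · obtain ⟨r, hr⟩ := hy n
      exact ⟨r, fun _ => hr⟩
    · exact ⟨0, fun h => absurd h hy⟩
  choose r hr using hchoice
  choose u huD hudisj hucov using fun n : ℕ =>
    Vitali.exists_disjoint_subfamily_covering_enlargement_ball D id (r n) (1 / ((n : ℝ) + 1))
      (fun y hy => (hr n y hy).2.1.le) 5 (by norm_num)
  have hdisj : ∀ n, Pairwise (Function.onFun Disjoint fun y : u n => ball (y : Y) (r n y)) :=
    fun n y z hyz => hudisj n y.2 z.2 (Subtype.coe_injective.ne hyz)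
  have hcount : ∀ n, Countable (u n) := fun n => by
    have h := Measure.countable_meas_pos_of_disjoint_iUnion (μ := ν)
      (fun y : u n => measurableSet_ball (x := (y : Y)) (ε := r n y)) (hdisj n)
    have huniv : {y : u n | 0 < ν (ball (y : Y) (r n y))} = univ :=
      eq_univ_of_forall fun y => (zero_le).trans_lt (hr n y (huD n y.2)).2.2
    rw [huniv] at h
    exact countable_univ_iff.1 h
  have hdiam : ∀ n (y : u n), ediam (ball (y : Y) (5 * r n y)) ≤ ENNReal.ofReal (10 * r n y) :=
    fun n y => by
      refine (ediam_mono ball_subset_closedBall).trans (ediam_le_of_forall_dist_le fun a ha b hb => ?_)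
      have := dist_triangle_right a b (y : Y)
      linarith [mem_closedBall.1 ha, mem_closedBall.1 hb]
  have hsum : ∀ n, ∑' y : u n, ediam (ball (y : Y) (5 * r n y)) ^ Q ≤
      ENNReal.ofReal (10 ^ Q * (1 / ((n : ℝ) + 1))) * ν univ := fun n =>
    calc ∑' y : u n, ediam (ball (y : Y) (5 * r n y)) ^ Q
        ≤ ∑' y : u n, ENNReal.ofReal (10 ^ Q * (1 / ((n : ℝ) + 1))) * ν (ball (y : Y) (r n y)) := by
          refine ENNReal.tsum_le_tsum fun y => ?_
          obtain ⟨h0, -, h2⟩ := hr n y (huD n y.2)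
          calc ediam (ball (y : Y) (5 * r n y)) ^ Q ≤ ENNReal.ofReal (10 * r n y) ^ Q :=
                ENNReal.rpow_le_rpow (hdiam n y) hQ.le
            _ = ENNReal.ofReal (10 ^ Q * (1 / ((n : ℝ) + 1))) *
                  ENNReal.ofReal ((n + 1) * r n y ^ Q) := by
                rw [ENNReal.ofReal_rpow_of_nonneg (by positivity) hQ.le,
                  ← ENNReal.ofReal_mul (by positivity), Real.mul_rpow (by norm_num) h0.le]
                congr 1
                field_simp
            _ ≤ _ := by gcongr
      _ = ENNReal.ofReal (10 ^ Q * (1 / ((n : ℝ) + 1))) * ∑' y : u n, ν (ball (y : Y) (r n y)) :=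
          ENNReal.tsum_mul_left
      _ ≤ _ := by
          gcongr
          exact tsum_measure_le_measure_univ
            (fun _ => measurableSet_ball.nullMeasurableSet) fun y z hyz => (hdisj n hyz).aedisjoint
  have htend : Tendsto (fun n : ℕ => ENNReal.ofReal (10 ^ Q * (1 / ((n : ℝ) + 1))) * ν univ) atTop
      (𝓝 0) := by
    have h1 : Tendsto (fun n : ℕ => ENNReal.ofReal (10 ^ Q * (1 / ((n : ℝ) + 1)))) atTop (𝓝 0) := by
      simpa using ENNReal.tendsto_ofReal
        ((tendsto_one_div_add_atTop_nhds_zero_nat (𝕜 := ℝ)).const_mul ((10 : ℝ) ^ Q))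
    simpa using ENNReal.Tendsto.mul_const h1 (Or.inr (measure_ne_top ν univ))
  have htend' : Tendsto (fun n : ℕ => ENNReal.ofReal (10 * (1 / ((n : ℝ) + 1)))) atTop (𝓝 0) := by
    simpa using ENNReal.tendsto_ofReal
      ((tendsto_one_div_add_atTop_nhds_zero_nat (𝕜 := ℝ)).const_mul (10 : ℝ))
  refine le_antisymm ?_ (zero_le)
  calc μH[Q] D ≤ liminf (fun n => ∑' y : u n, ediam (ball (y : Y) (5 * r n y)) ^ Q) atTop := by
        refine Measure.hausdorffMeasure_le_liminf_tsum Q D _ htend' _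
          (Eventually.of_forall fun n y => (hdiam n y).trans ?_) (Eventually.of_forall fun n y hy => ?_)
        · exact ENNReal.ofReal_le_ofReal
            (mul_le_mul_of_nonneg_left (hr n y (huD n y.2)).2.1.le (by norm_num))
        · obtain ⟨b, hb, hsub⟩ := hucov n y hy
          exact mem_iUnion.2 ⟨⟨b, hb⟩, hsub (mem_ball_self (hr n y hy).1)⟩
    _ ≤ liminf (fun n : ℕ => ENNReal.ofReal (10 ^ Q * (1 / ((n : ℝ) + 1))) * ν univ) atTop :=
        liminf_le_liminf (Eventually.of_forall hsum)
    _ = 0 := htend.liminf_eq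

/-- The points `x` such that, at scales below `1 / (n + 1)`, the preimages of balls centred at `f x`
have measure at most `(n + 1) r ^ Q`. -/
def boundedMultiplicitySet {X Y : Type*} [MetricSpace X] [MeasurableSpace X] [BorelSpace X]
    [MetricSpace Y] (Q : ℝ) (f : X → Y) (n : ℕ) : Set X :=
  {x | ∀ r, 0 < r → r < 1 / ((n : ℝ) + 1) →
    μH[Q] (f ⁻¹' ball (f x) r) ≤ ENNReal.ofReal ((n + 1) * r ^ Q)}

theorem exists_hausdorffMeasure_boundedMultiplicitySet_ne_zero {X Y : Type*} [MetricSpace X]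
    [MeasurableSpace X] [BorelSpace X] [MetricSpace Y] [MeasurableSpace Y] [BorelSpace Y]
    {Q : ℝ} (hQ : 0 < Q) [IsFiniteMeasure (μH[Q] : Measure X)] {f : X → Y} {L : NNReal}
    (hf : LipschitzWith L f) (hpos : 0 < μH[Q] (range f)) :
    ∃ n, μH[Q] (boundedMultiplicitySet Q f n) ≠ 0 := by
  by_contra! hcon
  set ν : Measure Y := Measure.map f μH[Q]
  have hν : ∀ y r, ν (ball y r) = μH[Q] (f ⁻¹' ball y r) := fun y r =>
    Measure.map_apply hf.continuous.measurable measurableSet_ball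
  have hsub : range f ⊆ (⋃ n, f '' boundedMultiplicitySet Q f n) ∪
      {y : Y | ∀ n : ℕ, ∃ r, 0 < r ∧ r < 1 / ((n : ℝ) + 1) ∧
        ENNReal.ofReal ((n + 1) * r ^ Q) < ν (ball y r)} := by
    rintro _ ⟨x, rfl⟩
    by_cases hx : ∃ n, x ∈ boundedMultiplicitySet Q f n
    · obtain ⟨n, hn⟩ := hx
      exact Or.inl (mem_iUnion.2 ⟨n, x, hn, rfl⟩)
    · refine Or.inr fun n => ?_
      have hn := not_exists.1 hx n
      simp only [boundedMultiplicitySet, mem_ofPred_eq] at hn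
      push Not at hn
      obtain ⟨r, h0, h1, h2⟩ := hn
      exact ⟨r, h0, h1, by rwa [hν]⟩
  refine hpos.ne' (measure_mono_null hsub (measure_union_null (measure_iUnion_null fun n => ?_)
    (hausdorffMeasure_setOf_unbounded_density ν hQ)))
  have := hf.hausdorffMeasure_image_le hQ.le (boundedMultiplicitySet Q f n)
  rw [hcon n, mul_zero] at this
  exact le_antisymm this (zero_le)

/-- Almost every point of `E` is a point around which `E` is asymptotically dense. -/
theorem exists_forall_eventually_closedBall_inter_nonempty {X : Type*} [MetricSpace X]
    [SecondCountableTopology X] [MeasurableSpace X] [BorelSpace X] (μ : Measure X)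
    [IsUnifLocDoublingMeasure μ] [IsLocallyFiniteMeasure μ] {E : Set X} (hE : μ E ≠ 0) :
    ∃ x₀, ∀ K : ℕ, ∀ᶠ δ in 𝓝[>] (0 : ℝ), ∀ z, dist x₀ z ≤ K * δ →
      (E ∩ closedBall z δ).Nonempty := by
  have hae := ae_all_iff.2 fun K : ℕ => IsUnifLocDoublingMeasure.ae_tendsto_measure_inter_div μ E K
  have : (ae (μ.restrict E)).NeBot := by
    rw [ae_neBot]
    exact fun h => hE (Measure.restrict_eq_zero.1 h)
  obtain ⟨x₀, hx₀⟩ := hae.exists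
  refine ⟨x₀, fun K => ?_⟩
  by_contra hcon
  rw [not_eventually] at hcon
  obtain ⟨δ, hδ, hbad⟩ := exists_seq_forall_of_frequently hcon
  push Not at hbad
  choose z hz hzE using hbad
  have := hx₀ K z δ hδ (Eventually.of_forall hz)
  simp only [hzE, measure_empty, ENNReal.zero_div] at this
  exact zero_ne_one (tendsto_nhds_unique tendsto_const_nhds this)

namespace AhlforsRegular

variable {X : Type*} [MetricSpace X] [MeasurableSpace X] [BorelSpace X] {Q : ℝ}

theorem isLocallyFiniteMeasure (hX : AhlforsRegular Q X) :
    IsLocallyFiniteMeasure (μH[Q] : Measure X) := by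
  obtain ⟨-, -, hdiam, C, -, hC⟩ := hX
  exact ⟨fun x => ⟨ball x (diam univ), ball_mem_nhds x hdiam,
    (hC x _ hdiam le_rfl).2.trans_lt ENNReal.ofReal_lt_top⟩⟩

theorem isUnifLocDoublingMeasure (hX : AhlforsRegular Q X) :
    IsUnifLocDoublingMeasure (μH[Q] : Measure X) := by
  obtain ⟨hQ, -, hdiam, C, hC1, hC⟩ := hX
  have hC0 : 0 < C := by linarith
  refine ⟨⟨Real.toNNReal (C ^ 2 * 4 ^ Q), ?_⟩⟩
  have hsmall : ∀ᶠ ε in 𝓝[>] (0 : ℝ), ε < diam (univ : Set X) / 4 :=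
    eventually_nhdsWithin_of_eventually_nhds (eventually_lt_nhds (by positivity))
  filter_upwards [hsmall, self_mem_nhdsWithin] with ε hε hε0 x
  replace hε0 : 0 < ε := hε0
  calc μH[Q] (closedBall x (2 * ε)) ≤ μH[Q] (ball x (4 * ε)) :=
        measure_mono (closedBall_subset_ball (by linarith))
    _ ≤ ENNReal.ofReal (C * (4 * ε) ^ Q) := (hC x _ (by linarith) (by linarith)).2
    _ = ENNReal.ofReal (C ^ 2 * 4 ^ Q) * ENNReal.ofReal (ε ^ Q / C) := by
        rw [← ENNReal.ofReal_mul (by positivity), Real.mul_rpow (by norm_num) hε0.le]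
        congr 1
        field_simp
    _ ≤ ENNReal.ofReal (C ^ 2 * 4 ^ Q) * μH[Q] (closedBall x ε) := by
        gcongr
        exact (hC x ε hε0 (by linarith)).1.trans (measure_mono ball_subset_closedBall)

theorem blowupTotallyBounded (hX : AhlforsRegular Q X) (p : X) : BlowupTotallyBounded p := by
  obtain ⟨hQ, -, hdiam, C, hC1, hC⟩ := hX
  have hC0 : 0 < C := by linarith
  intro R ε hR hε
  refine ⟨⌈C * (R + ε) ^ Q / ((ε / 2) ^ Q / C)⌉₊, ?_⟩
  have hbig : ∀ᶠ k : ℕ in atTop, (R + ε) / diam (univ : Set X) ≤ k :=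
    tendsto_natCast_atTop_atTop.eventually_ge_atTop _
  filter_upwards [hbig] with k hk
  set l : ℝ := (k : ℝ) + 1 with hl
  have hl0 : 0 < l := by positivity
  have hRd : (R + ε) / l ≤ diam (univ : Set X) := by
    rw [div_le_iff₀ hdiam] at hk
    rw [div_le_iff₀ hl0]
    nlinarith
  refine exists_finset_cover_of_separated_card_le (div_pos hε hl0) fun t htA hsep => ?_
  have hεR : ε / 2 / l ≤ (R + ε) / l := by gcongr; linarith
  have hcard := card_le_div_of_separated (μ := μH[Q]) (t := t) (U := ball p ((R + ε) / l))
    (s := ε / 2 / l) (a := (ε / 2 / l) ^ Q / C) (b := C * ((R + ε) / l) ^ Q)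
    (fun x hx y hy hxy => by
      have h := hsep hx hy hxy
      rw [← add_div, add_halves]
      exact h)
    (fun x hx => ball_subset_ball' (by
      have h : dist x p < R / l := htA hx
      have h' : ε / 2 / l ≤ ε / l := by gcongr; linarith
      rw [add_div]
      linarith))
    (by positivity) (by positivity)
    (fun x _ => (hC x _ (by positivity) (hεR.trans hRd)).1)
    (hC p _ (by positivity) hRd).2
  rw [← Nat.cast_le (α := ℝ)]
  refine hcard.trans (le_trans (le_of_eq ?_) (Nat.le_ceil _))
  rw [Real.div_rpow (by positivity) hl0.le, Real.div_rpow (by positivity) hl0.le]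
  have : 0 < l ^ Q := by positivity
  have : 0 < (ε / 2) ^ Q := by positivity
  field_simp

end AhlforsRegular

theorem MetricDoubling.blowupTotallyBounded {Y : Type*} [MetricSpace Y] (hY : MetricDoubling Y)
    (p : Y) : BlowupTotallyBounded p := by
  classical
  obtain ⟨M, hM⟩ := hY
  have hiter : ∀ (j : ℕ) (y : Y) (R : ℝ), ∃ t : Finset Y, t.card ≤ M ^ j ∧
      ball y R ⊆ ⋃ c ∈ t, ball c (R / 2 ^ j) := by
    intro j
    induction j with
    | zero => exact fun y R => ⟨{y}, by simp⟩
    | succ j ih =>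
      intro y R
      obtain ⟨t, ht, htc⟩ := ih y R
      choose u hu huc using fun c => hM c (R / 2 ^ j)
      refine ⟨t.biUnion u, ?_, fun z hz => ?_⟩
      · calc (t.biUnion u).card ≤ t.card * M := Finset.card_biUnion_le_card_mul _ _ _ fun c _ => hu c
          _ ≤ M ^ (j + 1) := by
            rw [pow_succ]
            gcongr
      · obtain ⟨c, hc, hzc⟩ := mem_iUnion₂.1 (htc hz)
        obtain ⟨d, hd, hzd⟩ := mem_iUnion₂.1 (huc c hzc)
        refine mem_iUnion₂.2 ⟨d, Finset.mem_biUnion.2 ⟨c, hc, hd⟩, ?_⟩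
        rwa [pow_succ, ← div_div]
  intro R ε hR hε
  obtain ⟨j, hj⟩ := pow_unbounded_of_one_lt (R / ε) one_lt_two
  refine ⟨M ^ j, Eventually.of_forall fun k => ?_⟩
  obtain ⟨t, ht, htc⟩ := hiter j p (R / ((k : ℝ) + 1))
  refine ⟨t, ht, htc.trans (iUnion₂_mono fun c _ => ball_subset_ball ?_)⟩
  rw [div_right_comm]
  gcongr
  rw [div_lt_iff₀ hε] at hj
  rw [div_le_iff₀ (by positivity)]
  linarith

theorem exists_lipschitzWith_comp_eq_of_denseRange {P S T : Type*} [MetricSpace S] [MetricSpace T]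
    [CompleteSpace T] {i : P → S} (hi : DenseRange i) {h : P → T} {L : NNReal}
    (hL : ∀ x y, dist (h x) (h y) ≤ L * dist (i x) (i y)) :
    ∃ g : S → T, LipschitzWith L g ∧ ∀ x, g (i x) = h x := by
  have hex : ∀ s, ∃ t, ∀ x, dist t (h x) ≤ L * dist s (i x) := by
    intro s
    choose x hx using fun n : ℕ =>
      hi.exists_dist_lt s (Nat.one_div_pos_of_nat (α := ℝ) (n := n))
    have hxs : Tendsto (fun n => i (x n)) atTop (𝓝 s) := by
      rw [tendsto_iff_dist_tendsto_zero]
      refine squeeze_zero (fun _ => dist_nonneg) (fun n => ?_)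
        (tendsto_one_div_add_atTop_nhds_zero_nat (𝕜 := ℝ))
      rw [dist_comm]
      exact (hx n).le
    have hcau : CauchySeq fun n => h (x n) := by
      refine cauchySeq_of_le_tendsto_0 (fun n : ℕ => (L : ℝ) * (2 * (1 / ((n : ℝ) + 1))))
        (fun n m N hn hm => (hL _ _).trans ?_) ?_
      · gcongr
        have h1 := Nat.one_div_le_one_div (α := ℝ) hn
        have h2 := Nat.one_div_le_one_div (α := ℝ) hm
        linarith [dist_triangle_left (i (x n)) (i (x m)) s, hx n, hx m]
      · simpa using ((tendsto_one_div_add_atTop_nhds_zero_nat (𝕜 := ℝ)).const_mul 2).const_mul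
          (L : ℝ)
    obtain ⟨t, ht⟩ := cauchySeq_tendsto_of_complete hcau
    exact ⟨t, fun y => le_of_tendsto_of_tendsto' (ht.dist tendsto_const_nhds)
      ((hxs.dist tendsto_const_nhds).const_mul (L : ℝ)) fun n => hL _ _⟩
  choose g hg using hex
  have hgi : ∀ x, g (i x) = h x := fun x => by
    have := hg (i x) x
    rw [dist_self, mul_zero] at this
    exact dist_le_zero.1 this
  refine ⟨g, LipschitzWith.of_dist_le_mul fun s s' => ?_, hgi⟩
  have hlim : Tendsto (fun ε : ℝ => (L : ℝ) * (dist s s' + 2 * ε)) (𝓝[>] 0)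
      (𝓝 (L * (dist s s' + 2 * 0))) :=
    (Continuous.tendsto (by fun_prop) 0).mono_left nhdsWithin_le_nhds
  rw [mul_zero, add_zero] at hlim
  refine ge_of_tendsto hlim ?_
  filter_upwards [self_mem_nhdsWithin] with ε hε
  obtain ⟨x, hx⟩ := hi.exists_dist_lt s' hε
  calc dist (g s) (g s') ≤ dist (g s) (h x) + dist (g s') (h x) := dist_triangle_right _ _ _
    _ ≤ L * dist s (i x) + L * dist s' (i x) := add_le_add (hg s x) (hg s' x)
    _ = L * (dist s (i x) + dist s' (i x)) := by ring
    _ ≤ L * (dist s s' + 2 * ε) := by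
      refine mul_le_mul_of_nonneg_left ?_ L.2
      linarith [dist_triangle s s' (i x)]

/-- Post-composition with a Lipschitz map. -/
def BlowupSeq.map {X Y : Type*} [MetricSpace X] [MetricSpace Y] {f : X → Y} {L : NNReal}
    (hf : LipschitzWith L f) {p : X} (x : BlowupSeq p) : BlowupSeq (f p) :=
  ⟨fun k => f (x.1 k), by
    obtain ⟨B, hB⟩ := x.2
    exact ⟨L * B, fun k => (hf.blowupDist_le k (x.1 k) p).trans
      (mul_le_mul_of_nonneg_left (hB k) L.2)⟩⟩

theorem BlowupSeq.dist_map_le {X Y : Type*} [MetricSpace X] [MetricSpace Y] {f : X → Y}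
    {L : NNReal} (hf : LipschitzWith L f) {p : X} (x y : BlowupSeq p) :
    dist (x.map hf) (y.map hf) ≤ L * dist x y :=
  le_of_tendsto_of_tendsto' (tendsto_dist (x.map hf) (y.map hf))
    ((tendsto_dist x y).const_mul (L : ℝ)) fun k => hf.blowupDist_le k (x.1 k) (y.1 k)

/-- The multiplicity bound for the blow-ups of `f` at a point around which the set of bounded
multiplicity is asymptotically dense. -/
theorem exists_card_le_of_separated_blowupSeq {X Y : Type*} [MetricSpace X] [MeasurableSpace X]
    [BorelSpace X] [MetricSpace Y] {Q : ℝ} (hX : AhlforsRegular Q X) {f : X → Y} {L : NNReal}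
    (hf : LipschitzWith L f) {n : ℕ} {p : X}
    (hdense : ∀ K : ℕ, ∀ᶠ δ in 𝓝[>] (0 : ℝ), ∀ z, dist p z ≤ K * δ →
      (boundedMultiplicitySet Q f n ∩ closedBall z δ).Nonempty) :
    ∃ N : ℕ, ∀ r : ℝ, 0 < r → ∀ (x₀ : BlowupSeq p) (A : Finset (BlowupSeq p)),
      (∀ a ∈ A, dist (a.map hf) (x₀.map hf) < 3 * r) →
      (A : Set (BlowupSeq p)).Pairwise (fun a b => r / 2 < dist a b) → A.card ≤ N := by
  classical
  obtain ⟨hQ, -, hdiam, C, hC1, hC⟩ := hX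
  have hC0 : 0 < C := by linarith
  refine ⟨⌈(n + 1) * (3 + 2 * L) ^ Q / ((1 / 4) ^ Q / C)⌉₊, fun r hr x₀ A hA hsep => ?_⟩
  obtain ⟨B, hB⟩ := x₀.2
  obtain ⟨K, hK⟩ := exists_nat_ge (B / r)
  have hscale : Tendsto (fun k : ℕ => r / ((k : ℝ) + 1)) atTop (𝓝[>] 0) := by
    refine tendsto_nhdsWithin_iff.2 ⟨?_, Eventually.of_forall fun k => div_pos hr (by positivity)⟩
    simpa [div_eq_mul_one_div r] using
      (tendsto_one_div_add_atTop_nhds_zero_nat (𝕜 := ℝ)).const_mul r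
  have hsmall : ∀ c : ℝ, 0 < c → ∀ᶠ k : ℕ in atTop, (3 + 2 * L) * (r / ((k : ℝ) + 1)) < c := by
    intro c hc
    have := (tendsto_nhds_of_tendsto_nhdsWithin hscale).const_mul (3 + 2 * (L : ℝ))
    rw [mul_zero] at this
    exact this.eventually_lt_const hc
  have ev1 : ∀ᶠ k in (hyperfilter ℕ : Filter ℕ), ∀ a ∈ A,
      blowupDist k (f (a.1 k)) (f (x₀.1 k)) < 3 * r :=
    (Finset.eventually_all A).2 fun a ha =>
      (BlowupSeq.tendsto_dist (a.map hf) (x₀.map hf)).eventually_lt_const (hA a ha)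
  have ev2 : ∀ᶠ k in (hyperfilter ℕ : Filter ℕ), ∀ a ∈ A, ∀ b ∈ A, a ≠ b →
      r / 2 < blowupDist k (a.1 k) (b.1 k) :=
    (Finset.eventually_all A).2 fun a ha => (Finset.eventually_all A).2 fun b hb => by
      by_cases hab : a = b
      · simp [hab]
      · filter_upwards [(BlowupSeq.tendsto_dist a b).eventually_const_lt (hsep ha hb hab)]
          with k hk _ using hk
  obtain ⟨k, h1, h2, h3, h4, h5⟩ := (ev1.and (ev2.and (Nat.hyperfilter_le_atTop
    ((hscale.eventually (hdense K)).and ((hsmall _ hdiam).and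
      (hsmall (1 / ((n : ℝ) + 1)) (by positivity))))))).exists
  set l : ℝ := (k : ℝ) + 1 with hl
  have hl0 : 0 < l := by positivity
  have hrl : 0 < r / l := div_pos hr hl0
  have hL0 : 0 ≤ (L : ℝ) := L.2
  obtain ⟨e, he, hex⟩ := h3 (x₀.1 k) (by
    rw [dist_comm, mul_div_assoc']
    refine (blowupDist_le_iff.1 (hB k)).trans ?_
    rw [div_le_iff₀ hr] at hK
    gcongr)
  have hinj : InjOn (fun a : BlowupSeq p => a.1 k) A := fun a ha b hb hab => by
    by_contra hne
    have h := h2 a ha b hb hne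
    simp only at hab
    rw [hab, blowupDist_self] at h
    linarith
  have hcard := card_le_div_of_separated (μ := μH[Q]) (t := A.image fun a => a.1 k)
    (U := f ⁻¹' ball (f e) ((3 + 2 * L) * (r / l))) (s := 1 / 4 * (r / l))
    (a := (1 / 4 * (r / l)) ^ Q / C) (b := (n + 1) * ((3 + 2 * L) * (r / l)) ^ Q)
    (fun x hx y hy hxy => by
      obtain ⟨a, ha, rfl⟩ := Finset.mem_image.1 hx
      obtain ⟨b, hb, rfl⟩ := Finset.mem_image.1 hy
      have h := h2 a ha b hb fun h => hxy (by rw [h])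
      rw [blowupDist, ← div_lt_iff₀' hl0, div_right_comm] at h
      linarith)
    (fun x hx z hz => by
      obtain ⟨a, ha, rfl⟩ := Finset.mem_image.1 hx
      have ha1 := blowupDist_lt_iff.1 (h1 a ha)
      rw [← hl, mul_div_assoc] at ha1
      have hz1 := hf.dist_le_mul z (a.1 k)
      have hz2 : (L : ℝ) * dist z (a.1 k) ≤ L * (1 / 4 * (r / l)) :=
        mul_le_mul_of_nonneg_left (mem_ball.1 hz).le hL0
      have he1 := hf.dist_le_mul e (x₀.1 k)
      have he2 : (L : ℝ) * dist e (x₀.1 k) ≤ L * (r / l) :=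
        mul_le_mul_of_nonneg_left (mem_closedBall.1 hex) hL0
      have t1 := dist_triangle (f z) (f (a.1 k)) (f e)
      have t2 := dist_triangle_right (f (a.1 k)) (f e) (f (x₀.1 k))
      have hLr : 0 ≤ (L : ℝ) * (r / l) := by positivity
      change dist (f z) (f e) < _
      linarith)
    (by positivity) (by positivity)
    (fun x _ => (hC x _ (by positivity) (by nlinarith)).1)
    (he _ (by positivity) h5)
  rw [Finset.card_image_of_injOn hinj] at hcard
  rw [← Nat.cast_le (α := ℝ)]
  refine hcard.trans (le_trans (le_of_eq ?_) (Nat.le_ceil _))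
  rw [Real.mul_rpow (by positivity) hrl.le, Real.mul_rpow (by positivity) hrl.le]
  have : 0 < (r / l) ^ Q := by positivity
  have : 0 < ((1 : ℝ) / 4) ^ Q := by positivity
  field_simp

/-- **David–Semmes / Bonk–Kleiner, Proposition 4.1.** If `f : X → Y` is Lipschitz,
`X` is compact and Ahlfors `Q`-regular, `Y` is complete and doubling, and the image
of `f` has positive `Q`-dimensional Hausdorff measure, then there are weak tangents
`S ∈ WT(X)`, `T ∈ WT(Y)` and a regular map `g : S → T`. -/
theorem exists_regular_map_between_weak_tangents {X Y : Type*} [MetricSpace X]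
    [CompactSpace X] [MeasurableSpace X] [BorelSpace X]
    [MetricSpace Y] [CompleteSpace Y] [MeasurableSpace Y] [BorelSpace Y]
    (Q : ℝ) (hX : AhlforsRegular Q X) (hY : MetricDoubling Y)
    (f : X → Y) (L : NNReal) (hf : LipschitzWith L f)
    (hpos : 0 < μH[Q] (range f)) :
    ∃ (S T : Type) (dS : MetricSpace S) (dT : MetricSpace T) (q : S) (q' : T)
      (g : S → T),
      @PointedWeakTangent X inferInstance S dS q ∧
      @PointedWeakTangent Y inferInstance T dT q' ∧
      @IsRegularMap S T dS dT g := by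
  have hQ : 0 < Q := hX.1
  have := hX.isLocallyFiniteMeasure
  have := hX.isUnifLocDoublingMeasure
  obtain ⟨n, hn⟩ := exists_hausdorffMeasure_boundedMultiplicitySet_ne_zero hQ hf hpos
  obtain ⟨p, hp⟩ := exists_forall_eventually_closedBall_inter_nonempty μH[Q] hn
  obtain ⟨S, dS, stS, hstS, hdS, hwS⟩ :=
    BlowupSeq.exists_pointedWeakTangent (hX.blowupTotallyBounded p)
  obtain ⟨T, dT, stT, hstT, hdT, hwT⟩ :=
    BlowupSeq.exists_pointedWeakTangent (hY.blowupTotallyBounded (f p))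
  have : CompleteSpace T := hwT.1
  obtain ⟨g, hg, hgst⟩ := exists_lipschitzWith_comp_eq_of_denseRange hdS
    (h := fun x => stT (x.map hf)) (L := L) fun x y => by
      rw [hstT.dist_eq, hstS.dist_eq]
      exact BlowupSeq.dist_map_le hf x y
  refine ⟨S, T, dS, dT, _, _, g, hwS, hwT, ⟨L, hg⟩, ?_⟩
  obtain ⟨N, hN⟩ := exists_card_le_of_separated_blowupSeq hX hf hp
  refine ⟨N, fun y r hr => exists_finset_cover_of_separated_card_le hr fun t htA hsep => ?_⟩
  classical
  obtain rfl | ⟨s₀, hs₀⟩ := t.eq_empty_or_nonempty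
  · simp
  have hL0 : 0 ≤ (L : ℝ) := L.2
  set ρ : ℝ := r / (8 * (L + 1)) with hρ
  have hρ0 : 0 < ρ := by positivity
  have hρL : (L + 1) * ρ = r / 8 := by
    rw [hρ]
    field_simp
  have hLρ : 0 ≤ L * ρ := by positivity
  choose x hx using fun s => hdS.exists_dist_lt s hρ0
  have hgx : ∀ s, dist (g s) (stT ((x s).map hf)) ≤ L * ρ := fun s => by
    rw [← hgst]
    exact (hg.dist_le_mul _ _).trans (mul_le_mul_of_nonneg_left (hx s).le hL0)
  have hsepx : ∀ s ∈ t, ∀ s' ∈ t, s ≠ s' → r / 2 < dist (x s) (x s') := fun s hs s' hs' hne => by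
    rw [← hstS.dist_eq]
    have h1 : r ≤ dist s s' := hsep hs hs' hne
    have h2 := dist_triangle4_right s s' (stS (x s)) (stS (x s'))
    linarith [hx s, hx s']
  have hinj : InjOn x t := fun s hs s' hs' he => by
    by_contra hne
    have := hsepx s hs s' hs' hne
    rw [he, dist_self] at this
    linarith
  rw [← Finset.card_image_of_injOn hinj]
  refine hN r hr (x s₀) _ (fun a ha => ?_) fun a ha b hb hab => ?_
  · obtain ⟨s, hs, rfl⟩ := Finset.mem_image.1 ha
    rw [← hstT.dist_eq]
    have h1 : dist (g s) y < r := htA hs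
    have h2 : dist (g s₀) y < r := htA hs₀
    have h3 := dist_triangle_right (g s) (g s₀) y
    have h4 := dist_triangle4_left (g s) (g s₀) (stT ((x s).map hf)) (stT ((x s₀).map hf))
    linarith [hgx s, hgx s₀]
  · obtain ⟨s, hs, rfl⟩ := Finset.mem_image.1 ha
    obtain ⟨s', hs', rfl⟩ := Finset.mem_image.1 hb
    exact hsepx s hs s' hs' fun h => hab (by rw [h])
end
end

section
/- Suppose X and Y are complete doubling metric spaces, and suppose there exist a point x ∈ X, a neighborhood U of x, and a bi-Lipschitz map f : U → V := f(U) ⊆ Y such that V is a neighborhood of y := f(x). Then there exist weak tangents S ∈ WT(X) and T ∈ WT(Y) and a bi-Lipschitz homeomorphism g : S → T. -/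
open Metric Set MeasureTheory Filter Topology

noncomputable section

/-- `g` is a bi-Lipschitz homeomorphism. -/
def IsBiLipschitzEquiv {S T : Type*} [MetricSpace S] [MetricSpace T] (g : S → T) : Prop :=
  Function.Bijective g ∧ ∃ L : ℝ, 1 ≤ L ∧ ∀ a b : S,
    dist a b / L ≤ dist (g a) (g b) ∧ dist (g a) (g b) ≤ L * dist a b

namespace MetricDoubling

/-- Iterating the doubling condition `m` times. -/
lemma exists_iterated_cover {Z : Type*} [MetricSpace Z] (hZ : MetricDoubling Z) (m : ℕ) :
    ∃ N : ℕ, ∀ (z : Z) (R : ℝ), ∃ t : Finset Z, t.card ≤ N ∧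
      ball z R ⊆ ⋃ c ∈ t, ball c (R / 2 ^ m) := by
  classical
  obtain ⟨M, hM⟩ := hZ
  induction m with
  | zero => exact ⟨1, fun z R => ⟨{z}, by simp⟩⟩
  | succ m ih =>
    obtain ⟨N, hN⟩ := ih
    refine ⟨N * M, fun z R => ?_⟩
    obtain ⟨t, ht, hcov⟩ := hN z R
    choose s hs hscov using fun c : Z => hM c (R / 2 ^ m)
    refine ⟨t.biUnion s, (Finset.card_biUnion_le_card_mul t s M fun c _ => hs c).trans
      (Nat.mul_le_mul_right M ht), fun w hw => ?_⟩
    obtain ⟨c, hc, hwc⟩ := mem_iUnion₂.1 (hcov hw)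
    obtain ⟨d, hd, hwd⟩ := mem_iUnion₂.1 (hscov c hwc)
    refine mem_iUnion₂.2 ⟨d, Finset.mem_biUnion.2 ⟨c, hc, hd⟩, ?_⟩
    rwa [pow_succ, ← div_div]

/-- At every scale `l`, the ball of rescaled radius `2 ^ m` about `z` has a `2⁻ᵐ`-net whose size
depends only on `m`. -/
lemma exists_net {Z : Type*} [MetricSpace Z] (hZ : MetricDoubling Z) (m : ℕ) :
    ∃ N : ℕ, ∀ (z : Z) (l : ℝ), 0 < l → ∃ e : ℕ → Z, ∀ w, l * dist w z < 2 ^ m →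
      ∃ j < N, l * dist w (e j) < (1 / 2) ^ m := by
  obtain ⟨N, hN⟩ := hZ.exists_iterated_cover (2 * m)
  refine ⟨N, fun z l hl => ?_⟩
  obtain ⟨t, ht, hcov⟩ := hN z (2 ^ m / l)
  refine ⟨fun j => t.toList.getD j z, fun w hw => ?_⟩
  have hw' : w ∈ ball z (2 ^ m / l) := by
    rw [mem_ball, lt_div_iff₀ hl]
    linarith
  obtain ⟨c, hc, hwc⟩ := mem_iUnion₂.1 (hcov hw')
  obtain ⟨j, hj, rfl⟩ := List.mem_iff_getElem.1 (Finset.mem_toList.2 hc)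
  refine ⟨j, (hj.trans_eq t.length_toList).trans_le ht, ?_⟩
  rw [mem_ball, div_div, lt_div_iff₀ (by positivity)] at hwc
  simp only [List.getD_eq_getElem _ _ hj]
  rw [one_div, inv_pow, ← one_div, lt_div_iff₀ (by positivity)]
  have h2 : (0 : ℝ) < 2 ^ m := by positivity
  have h3 : (2 : ℝ) ^ (2 * m) = 2 ^ m * 2 ^ m := by rw [two_mul, pow_add]
  rw [h3] at hwc
  nlinarith

end MetricDoubling

/-- For every `R` and `ε`, finitely many indices suffice for the points `c k i` to be eventually
`ε`-dense in the ball of radius `R` about `p`, distances being rescaled by `lam k`. -/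
def AsymptoticallyDense {Z ι : Type*} [MetricSpace Z] (lam : ℕ → ℝ) (p : Z) (c : ℕ → ι → Z) :
    Prop :=
  ∀ R > (0:ℝ), ∀ ε > (0:ℝ), ∃ F : Finset ι, ∀ᶠ k in atTop, ∀ z, lam k * dist z p < R →
    ∃ i ∈ F, lam k * dist z (c k i) < ε

lemma AsymptoticallyDense.comp {Z ι : Type*} [MetricSpace Z] {lam : ℕ → ℝ} {p : Z}
    {c : ℕ → ι → Z} (h : AsymptoticallyDense lam p c) {φ : ℕ → ℕ} (hφ : Tendsto φ atTop atTop) :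
    AsymptoticallyDense (lam ∘ φ) p (c ∘ φ) := fun R hR ε hε =>
  (h R hR ε hε).imp fun _ hF => hφ.eventually hF

lemma eventually_mem_of_mul_dist_lt {Z : Type*} [MetricSpace Z] {lam : ℕ → ℝ}
    (hlam : Tendsto lam atTop atTop) {p : Z} {U : Set Z} (hU : U ∈ 𝓝 p) (R : ℝ) :
    ∀ᶠ k in atTop, ∀ z, lam k * dist z p < R → z ∈ U := by
  obtain ⟨r, hr, hrU⟩ := Metric.mem_nhds_iff.1 hU
  filter_upwards [hlam.eventually_ge_atTop (R / r), hlam.eventually_gt_atTop 0] with k hk hk0 z hz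
  refine hrU (mem_ball.2 (lt_of_mul_lt_mul_left (hz.trans_le ?_) hk0.le))
  rwa [div_le_iff₀ hr] at hk

/-- A doubling space has an asymptotically dense family indexed by a countable set, contained in
a given neighborhood of `x` and bounded at each index. -/
lemma MetricDoubling.exists_asymptoticallyDense {X : Type*} [MetricSpace X]
    (hX : MetricDoubling X) {x : X} {U : Set X} (hU : U ∈ 𝓝 x) {lam : ℕ → ℝ}
    (hpos : ∀ k, 0 < lam k) (hlam : Tendsto lam atTop atTop) :
    ∃ c : ℕ → Option (ℕ × ℕ) → X, (∀ k, c k none = x) ∧ (∀ k i, c k i ∈ U) ∧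
      (∀ i, ∃ b : ℝ, ∀ k, lam k * dist (c k i) x ≤ b) ∧ AsymptoticallyDense lam x c := by
  classical
  choose N hN using hX.exists_net
  choose e he using fun m k => hN m x (lam k) (hpos k)
  have hxU := mem_of_mem_nhds hU
  refine ⟨fun k i => i.elim x fun mj =>
      if e mj.1 k mj.2 ∈ U ∧ lam k * dist (e mj.1 k mj.2) x ≤ 2 ^ mj.1 + 1 then
        e mj.1 k mj.2 else x, fun k => rfl, ?_, ?_, ?_⟩
  · rintro k (_ | ⟨m, j⟩)
    · exact hxU
    · simp only [Option.elim_some]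
      split_ifs with h
      exacts [h.1, hxU]
  · rintro (_ | ⟨m, j⟩)
    · exact ⟨0, fun k => by simp⟩
    · refine ⟨2 ^ m + 1, fun k => ?_⟩
      simp only [Option.elim_some]
      split_ifs with h
      · exact h.2
      · rw [dist_self, mul_zero]; positivity
  · intro R hR ε hε
    obtain ⟨m₁, hm₁⟩ := pow_unbounded_of_one_lt R (one_lt_two : (1 : ℝ) < 2)
    obtain ⟨m₂, hm₂⟩ := exists_pow_lt_of_lt_one hε (by norm_num : (1 / 2 : ℝ) < 1)
    set m := max m₁ m₂
    have hRm : R < 2 ^ m := hm₁.trans_le (pow_le_pow_right₀ one_le_two (le_max_left _ _))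
    have hεm : (1 / 2 : ℝ) ^ m < ε :=
      (pow_le_pow_of_le_one (by norm_num) (by norm_num) (le_max_right _ _)).trans_lt hm₂
    refine ⟨(Finset.range (N m)).image fun j => some (m, j), ?_⟩
    filter_upwards [eventually_mem_of_mul_dist_lt hlam hU (2 ^ m + 1)] with k hk z hz
    obtain ⟨j, hj, hzj⟩ := he m k z (hz.trans hRm)
    refine ⟨some (m, j), Finset.mem_image_of_mem _ (Finset.mem_range.2 hj), ?_⟩
    have hle : lam k * dist (e m k j) x < 2 ^ m + 1 := by
      have h1 : (1 / 2 : ℝ) ^ m ≤ 1 := pow_le_one₀ (by norm_num) (by norm_num)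
      have h2 := mul_le_mul_of_nonneg_left (dist_triangle_left (e m k j) x z) (hpos k).le
      linarith
    simp only [Option.elim_some, if_pos (And.intro (hk _ hle) hle.le)]
    exact hzj.trans hεm

/-- The image of an asymptotically dense family under a bi-Lipschitz map onto a neighborhood. -/
lemma AsymptoticallyDense.image {X Y ι : Type*} [MetricSpace X] [MetricSpace Y] {lam : ℕ → ℝ}
    (hpos : ∀ k, 0 < lam k) (hlam : Tendsto lam atTop atTop) {x : X} {U : Set X} (hx : x ∈ U)
    {f : X → Y} {L : ℝ} (hL : 1 ≤ L)
    (hbl : ∀ a ∈ U, ∀ b ∈ U,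
      dist a b / L ≤ dist (f a) (f b) ∧ dist (f a) (f b) ≤ L * dist a b)
    (hV : f '' U ∈ 𝓝 (f x)) {c : ℕ → ι → X} (hcU : ∀ k i, c k i ∈ U)
    (hc : AsymptoticallyDense lam x c) :
    AsymptoticallyDense lam (f x) fun k i => f (c k i) := by
  intro R hR ε hε
  have hL0 : 0 < L := one_pos.trans_le hL
  obtain ⟨F, hF⟩ := hc (R * L) (by positivity) (ε / L) (by positivity)
  refine ⟨F, ?_⟩
  filter_upwards [hF, eventually_mem_of_mul_dist_lt hlam hV R] with k hk hkV z hz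
  obtain ⟨w, hw, rfl⟩ := hkV z hz
  have hwx : lam k * dist w x < R * L := by
    have h := (div_le_iff₀ hL0).1 (hbl w hw x hx).1
    have h' := mul_le_mul_of_nonneg_left h (hpos k).le
    nlinarith
  obtain ⟨i, hi, hwi⟩ := hk w hwx
  refine ⟨i, hi, ?_⟩
  have h := mul_le_mul_of_nonneg_left (hbl w hw _ (hcU k i)).2 (hpos k).le
  rw [lt_div_iff₀ hL0] at hwi
  linarith

/-- If rescaled distances of an asymptotically dense family converge to the distances of a dense
family, then bounded parts of the latter are totally bounded. -/
lemma AsymptoticallyDense.totallyBounded {Z ι S : Type*} [MetricSpace Z] [MetricSpace S]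
    {lam : ℕ → ℝ} {p : Z} {c : ℕ → ι → Z} (hc : AsymptoticallyDense lam p c) {i₀ : ι}
    (hc₀ : ∀ k, c k i₀ = p) {e : ι → S}
    (hlim : ∀ i j, Tendsto (fun k => lam k * dist (c k i) (c k j)) atTop
      (𝓝 (dist (e i) (e j)))) {R : ℝ} (hR : 0 < R) :
    TotallyBounded (range e ∩ ball (e i₀) R) := by
  refine Metric.totallyBounded_iff.2 fun ε hε => ?_
  obtain ⟨F, hF⟩ := hc R hR (ε / 2) (by positivity)
  refine ⟨e '' F, F.finite_toSet.image e, ?_⟩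
  rintro _ ⟨⟨i, rfl⟩, hi⟩
  have hi' : ∀ᶠ k in atTop, lam k * dist (c k i) p < R := by
    simpa only [hc₀] using (hlim i i₀).eventually_lt_const hi
  have hex : ∃ᶠ k in atTop, ∃ j ∈ F, lam k * dist (c k i) (c k j) < ε / 2 :=
    (hF.and hi').frequently.mono fun k hk => hk.1 _ hk.2
  obtain ⟨j, hj, hij⟩ : ∃ j ∈ F, ∃ᶠ k in atTop, lam k * dist (c k i) (c k j) < ε / 2 := by
    by_contra! hcon
    refine hex ?_
    filter_upwards [(Finset.eventually_all F).2 hcon] with k hk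
    rintro ⟨j, hj, hlt⟩
    exact hlt.not_ge (hk j hj)
  have hle : dist (e i) (e j) ≤ ε / 2 := by
    by_contra! hlt
    exact hij (((hlim i j).eventually_const_lt hlt).mono fun k hk => hk.not_gt)
  exact mem_iUnion₂.2 ⟨e j, mem_image_of_mem e hj, mem_ball.2 (by linarith)⟩

/-- A complete space containing a dense set of limits of an asymptotically dense family is a weak
tangent. Since the approximating sets must lie in open balls, the dilation factors are slightly
enlarged: otherwise points of the rescaled spaces inside a ball could converge to points isolated
on its boundary. -/
lemma AsymptoticallyDense.pointedWeakTangent {Z ι S : Type*} [MetricSpace Z] [MetricSpace S]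
    [CompleteSpace S] [Countable ι] {lam : ℕ → ℝ} (hpos : ∀ k, 0 < lam k)
    (hlam : Tendsto lam atTop atTop) {p : Z} {c : ℕ → ι → Z} (hc : AsymptoticallyDense lam p c)
    {i₀ : ι} (hc₀ : ∀ k, c k i₀ = p) {e : ι → S} (he : DenseRange e)
    (hlim : ∀ i j, Tendsto (fun k => lam k * dist (c k i) (c k j)) atTop
      (𝓝 (dist (e i) (e j)))) :
    PointedWeakTangent Z S (e i₀) := by
  classical
  obtain ⟨code, hcode⟩ := Countable.exists_injective_nat ι
  set δ : ℕ → ℝ := fun n => 1 / ((n : ℝ) + 1) with hδ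
  have hδ0 : ∀ n, 0 < δ n := fun n => Nat.one_div_pos_of_nat
  have hδ1 : ∀ n, δ n ≤ 1 := fun n => by
    rw [hδ]; exact div_le_one_of_le₀ (by linarith [n.cast_nonneg (α := ℝ)]) (by positivity)
  have hδt : Tendsto δ atTop (𝓝 0) := tendsto_one_div_add_atTop_nhds_zero_nat
  choose F hF using fun n : ℕ => hc (n + 1) n.cast_add_one_pos (δ n ^ 2) (pow_pos (hδ0 n) 2)
  have hfin : ∀ n : ℕ, {i | code i < n}.Finite := fun n =>
    (Set.finite_lt_nat n).preimage hcode.injOn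
  set G : ℕ → Finset ι := fun n => F n ∪ (hfin n).toFinset ∪ {i₀} with hG
  have hdist : ∀ n, ∀ᶠ k in atTop, ∀ i ∈ G n, ∀ j ∈ G n,
      |lam k * dist (c k i) (c k j) - dist (e i) (e j)| < δ n ^ 2 := fun n =>
    (Finset.eventually_all _).2 fun i _ => (Finset.eventually_all _).2 fun j _ =>
      (Metric.tendsto_nhds.1 (hlim i j)) _ (pow_pos (hδ0 n) 2)
  choose K hK using fun n => ((hF n).and ((hdist n).and (eventually_ge_atTop n))).exists
  have hKt : Tendsto K atTop atTop := tendsto_atTop_mono (fun n => (hK n).2.2) tendsto_id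
  set lam' : ℕ → ℝ := fun n => (1 + δ n) * lam (K n) with hlam'
  have hlim' : ∀ i j, Tendsto (fun n => lam' n * dist (c (K n) i) (c (K n) j)) atTop
      (𝓝 (dist (e i) (e j))) := fun i j => by
    have := (hδt.const_add 1).mul ((hlim i j).comp hKt)
    simpa [hlam', mul_assoc, Function.comp_def] using this
  refine ⟨inferInstance, lam', fun _ => p, fun n => mul_pos (by linarith [hδ0 n]) (hpos _),
    tendsto_atTop_mono (fun n => ?_) (hlam.comp hKt), fun R hR ε hε => ?_⟩
  · simp only [Function.comp_apply, hlam']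
    nlinarith [hδ0 n, hpos (K n)]
  obtain ⟨t₀, ht₀s, ht₀fin, ht₀cov⟩ := totallyBounded_iff_subset.1
    (hc.totallyBounded hc₀ hlim hR) _ (Metric.dist_mem_uniformity (by positivity : 0 < ε / 4))
  set t := insert (e i₀) t₀
  have hts : t ⊆ range e ∩ ball (e i₀) R :=
    insert_subset ⟨mem_range_self _, mem_ball_self hR⟩ ht₀s
  have htfin : t.Finite := ht₀fin.insert _
  have htcov : ∀ i, dist (e i) (e i₀) < R → ∃ m ∈ t, dist (e i) m < ε / 4 := fun i hi => by
    obtain ⟨m, hm, him⟩ := mem_iUnion₂.1 (ht₀cov ⟨mem_range_self i, hi⟩)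
    exact ⟨m, mem_insert_of_mem _ hm, him⟩
  obtain ⟨r, hr₀, hr⟩ : ∃ r : S → ι, r (e i₀) = i₀ ∧ ∀ m ∈ t, e (r m) = m := by
    have hex : ∀ m : S, ∃ i, (m = e i₀ → i = i₀) ∧ (m ∈ t → e i = m) := fun m => by
      by_cases hm : m = e i₀
      · exact ⟨i₀, fun _ => rfl, fun _ => hm.symm⟩
      · by_cases hmt : m ∈ t
        · obtain ⟨i, hi⟩ := (hts hmt).1
          exact ⟨i, fun h => (hm h).elim, fun _ => hi⟩
        · exact ⟨i₀, fun _ => rfl, fun h => (hmt h).elim⟩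
    choose r hr using hex
    exact ⟨r, (hr _).1 rfl, fun m => (hr m).2⟩
  have hsmall : ∀ᶠ n in atTop, δ n < R / 4 ∧ δ n < ε / 8 ∧ R < n + 1 :=
    (hδt.eventually_lt_const (by positivity)).and
      ((hδt.eventually_lt_const (by positivity)).and
        ((tendsto_atTop_add_const_right _ _ tendsto_natCast_atTop_atTop).eventually_gt_atTop R))
  have hcodes : ∀ᶠ n in atTop, ∀ m ∈ t, code (r m) < n :=
    (htfin.eventually_all).2 fun m _ => eventually_gt_atTop _
  have hin : ∀ᶠ n in atTop, ∀ m ∈ t, lam' n * dist (c (K n) (r m)) p < R :=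
    (htfin.eventually_all).2 fun m hm => by
      have h : dist (e (r m)) (e i₀) < R := by rw [hr m hm]; exact (hts hm).2
      simpa only [hc₀] using (hlim' (r m) i₀).eventually_lt_const h
  have hsep : ∀ᶠ n in atTop, ∀ m ∈ t, ∀ m' ∈ t, m ≠ m' →
      0 < lam' n * dist (c (K n) (r m)) (c (K n) (r m')) :=
    (htfin.eventually_all).2 fun m hm => (htfin.eventually_all).2 fun m' hm' => by
      by_cases hne : m = m'
      · exact .of_forall fun _ h => (h hne).elim
      · have h : 0 < dist (e (r m)) (e (r m')) := by
          rw [hr m hm, hr m' hm']; exact dist_pos.2 hne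
        exact ((hlim' _ _).eventually_const_lt h).mono fun _ h _ => h
  have hnear : ∀ᶠ n in atTop, ∀ m ∈ t, ∀ m' ∈ t,
      |lam' n * dist (c (K n) (r m)) (c (K n) (r m')) - dist m m'| < ε :=
    (htfin.eventually_all).2 fun m hm => (htfin.eventually_all).2 fun m' hm' => by
      have := Metric.tendsto_nhds.1 (hlim' (r m) (r m')) ε hε
      rwa [hr m hm, hr m' hm'] at this
  obtain ⟨n₀, hn₀⟩ := eventually_atTop.1
    (hsmall.and (hcodes.and (hin.and (hsep.and hnear))))
  refine ⟨n₀, t, mem_insert _ _, hts.trans inter_subset_right, fun s hs => ?_, fun n hn => ?_⟩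
  · obtain ⟨i, hi, his⟩ := he.exists_mem_open (isOpen_ball.inter isOpen_ball)
      ⟨s, hs, mem_ball_self (by positivity : 0 < ε / 4)⟩
    obtain ⟨m, hm, him⟩ := htcov i hi
    refine ⟨m, hm, ?_⟩
    have := dist_triangle_left s m (e i)
    rw [mem_ball] at his
    linarith
  obtain ⟨⟨hδR, hδε, hRn⟩, hcodes, hin, hsep, hnear⟩ := hn₀ n hn
  set a : S → Z := fun m => c (K n) (r m) with ha
  have hinj : InjOn a t := fun m hm m' hm' hmm' => by
    by_contra hne
    have h := hsep m hm m' hm' hne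
    simp only [ha] at hmm'
    rw [hmm', dist_self, mul_zero] at h
    exact h.false
  have hap : a (e i₀) = p := by simp only [ha, hr₀, hc₀]
  have : Nonempty S := ⟨e i₀⟩
  have hinv : LeftInvOn (Function.invFunOn a t) a t := hinj.leftInvOn_invFunOn
  refine ⟨a '' t, Function.invFunOn a t, ⟨_, mem_insert _ _, hap⟩, ?_, fun z hz => ?_, ?_, ?_, ?_⟩
  · rintro _ ⟨m, hm, rfl⟩
    exact hin m hm
  · have hlamK := hpos (K n)
    have hδn := hδ0 n
    have hδn1 := hδ1 n
    have hzδ : (1 + δ n) * (lam (K n) * dist z p) < R := by rwa [← mul_assoc]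
    have hz0 : 0 ≤ lam (K n) * dist z p := mul_nonneg hlamK.le dist_nonneg
    obtain ⟨i, hi, hzi⟩ := (hK n).1 z (by nlinarith)
    have hiG : i ∈ G n := by simp [hG, hi]
    have hip := abs_lt.1 ((hK n).2.1 i hiG i₀ (by simp [hG]))
    have htri := mul_le_mul_of_nonneg_left (dist_triangle_left (c (K n) i) p z) hlamK.le
    rw [hc₀] at hip
    have hiR : dist (e i) (e i₀) < R := by
      have h1 : dist (e i) (e i₀) < lam (K n) * dist z p + 2 * δ n ^ 2 := by linarith
      have h2 : (1 + δ n) * dist (e i) (e i₀) < R + 2 * δ n ^ 2 * (1 + δ n) := by nlinarith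
      have h3 : 2 * δ n ^ 2 * (1 + δ n) ≤ δ n * R := by nlinarith
      nlinarith
    obtain ⟨m, hm, him⟩ := htcov i hiR
    refine ⟨a m, mem_image_of_mem a hm, ?_⟩
    have hrG : r m ∈ G n := by simp [hG, hcodes m hm]
    have himG := abs_lt.1 ((hK n).2.1 i hiG (r m) hrG)
    rw [hr m hm] at himG
    have htri' := mul_le_mul_of_nonneg_left (dist_triangle z (c (K n) i) (a m)) hlamK.le
    have hsq : δ n ^ 2 ≤ δ n := by nlinarith
    have hlt : lam (K n) * dist z (a m) < ε / 2 := by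
      have : lam (K n) * dist (c (K n) i) (a m) < δ n ^ 2 + ε / 4 := by linarith
      linarith
    have hnn : 0 ≤ lam (K n) * dist z (a m) := mul_nonneg hlamK.le dist_nonneg
    simp only [hlam', mul_assoc]
    nlinarith
  · simpa only [hap] using hinv (mem_insert (e i₀) t₀)
  · refine ⟨?_, ?_, fun m hm => ⟨a m, mem_image_of_mem a hm, hinv hm⟩⟩
    · rintro _ ⟨m, hm, rfl⟩
      rwa [hinv hm]
    · rintro _ ⟨m, hm, rfl⟩ _ ⟨m', hm', rfl⟩ h
      rw [hinv hm, hinv hm'] at h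
      rw [h]
  · rintro _ ⟨m, hm, rfl⟩ _ ⟨m', hm', rfl⟩
    rw [hinv hm, hinv hm']
    exact hnear m hm m' hm'

/-- A bijection distorting pseudometrics by a bounded factor extends to the completions. -/
lemma isBiLipschitzEquiv_completionMap {A B : Type*} [PseudoMetricSpace A] [PseudoMetricSpace B]
    (h : A ≃ B) {L : ℝ} (hL : 1 ≤ L)
    (hbl : ∀ a b, dist a b / L ≤ dist (h a) (h b) ∧ dist (h a) (h b) ≤ L * dist a b) :
    IsBiLipschitzEquiv (UniformSpace.Completion.map h) := by
  have hL0 : 0 < L := one_pos.trans_le hL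
  have hu : UniformContinuous h :=
    (LipschitzWith.of_dist_le_mul (K := ⟨L, hL0.le⟩) fun a b => (hbl a b).2).uniformContinuous
  have hu' : UniformContinuous h.symm :=
    (LipschitzWith.of_dist_le_mul (K := ⟨L, hL0.le⟩) fun a b => by
      have := (div_le_iff₀ hL0).1 (hbl (h.symm a) (h.symm b)).1
      rw [h.apply_symm_apply, h.apply_symm_apply, mul_comm] at this
      exact this).uniformContinuous
  refine ⟨Function.bijective_iff_has_inverse.2 ⟨UniformSpace.Completion.map h.symm, fun a => ?_,
    fun b => ?_⟩, L, hL, fun a b => ?_⟩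
  · have := congrFun (UniformSpace.Completion.map_comp hu' hu) a
    simpa [UniformSpace.Completion.map_id] using this
  · have := congrFun (UniformSpace.Completion.map_comp hu hu') b
    simpa [UniformSpace.Completion.map_id] using this
  · have hm : Continuous (UniformSpace.Completion.map h) := UniformSpace.Completion.continuous_map
    refine UniformSpace.Completion.induction_on₂ a b ?_ fun a b => ?_
    · rw [ofPred_and]
      exact (isClosed_le (by fun_prop) (by fun_prop)).inter
        (isClosed_le (by fun_prop) (by fun_prop))
    · rw [UniformSpace.Completion.map_coe hu, UniformSpace.Completion.map_coe hu,
        UniformSpace.Completion.dist_eq, UniformSpace.Completion.dist_eq]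
      exact hbl a b

/-- A pointwise limit of rescaled distances is a pseudometric. -/
abbrev limitPseudoMetric {Z ι : Type*} [MetricSpace Z] {lam : ℕ → ℝ} (hpos : ∀ k, 0 < lam k)
    {c : ℕ → ι → Z} {D : ι → ι → ℝ}
    (hlim : ∀ i j, Tendsto (fun k => lam k * dist (c k i) (c k j)) atTop (𝓝 (D i j))) :
    PseudoMetricSpace ι where
  dist := D
  dist_self i := tendsto_nhds_unique (hlim i i) (by simp)
  dist_comm i j := tendsto_nhds_unique (hlim i j) (by simpa only [dist_comm] using hlim j i)
  dist_triangle i j l := le_of_tendsto_of_tendsto' (hlim i l) ((hlim i j).add (hlim j l))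
    fun k => by
      rw [← mul_add]
      exact mul_le_mul_of_nonneg_left (dist_triangle _ _ _) (hpos k).le

/-- **Bonk–Kleiner, Lemma 4.3.** If complete doubling metric spaces `X` and `Y`
contain a point `x` with a neighborhood `U` and a bi-Lipschitz map `f : U → f(U)`
whose image is a neighborhood of `f(x)`, then `X` and `Y` have bi-Lipschitz
equivalent weak tangents. -/
theorem biLipschitz_weak_tangents {X Y : Type*} [MetricSpace X] [CompleteSpace X]
    [MetricSpace Y] [CompleteSpace Y]
    (hX : MetricDoubling X) (hY : MetricDoubling Y)
    (x : X) (U : Set X) (hU : U ∈ nhds x) (f : X → Y)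
    (L : ℝ) (hL : 1 ≤ L)
    (hbl : ∀ a ∈ U, ∀ b ∈ U,
      dist a b / L ≤ dist (f a) (f b) ∧ dist (f a) (f b) ≤ L * dist a b)
    (hV : f '' U ∈ nhds (f x)) :
    ∃ (S T : Type) (dS : MetricSpace S) (dT : MetricSpace T) (q : S) (q' : T)
      (g : S → T),
      @PointedWeakTangent X inferInstance S dS q ∧
      @PointedWeakTangent Y inferInstance T dT q' ∧
      @IsBiLipschitzEquiv S T dS dT g := by
  have hxU := mem_of_mem_nhds hU
  have hL0 : 0 < L := one_pos.trans_le hL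
  set lam : ℕ → ℝ := fun k => (k : ℝ) + 1
  have hpos : ∀ k, 0 < lam k := fun k => k.cast_add_one_pos
  have hlam : Tendsto lam atTop atTop :=
    tendsto_atTop_add_const_right _ _ tendsto_natCast_atTop_atTop
  obtain ⟨c, hc₀, hcU, hcb, hc⟩ := hX.exists_asymptoticallyDense hU hpos hlam
  choose b hb using hcb
  have hd : ∀ k i j, lam k * dist (c k i) (c k j) ≤ b i + b j := fun k i j => by
    have := mul_le_mul_of_nonneg_left (dist_triangle_right (c k i) (c k j) x) (hpos k).le
    linarith [hb i k, hb j k]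
  have hfd : ∀ k i j, lam k * dist (f (c k i)) (f (c k j)) ≤ L * (b i + b j) := fun k i j => by
    have := mul_le_mul_of_nonneg_left (hbl _ (hcU k i) _ (hcU k j)).2 (hpos k).le
    nlinarith [hd k i j]
  obtain ⟨D, -, φ, hφ, hD⟩ := (isCompact_univ_pi fun ij : Option (ℕ × ℕ) × Option (ℕ × ℕ) =>
    (isCompact_Icc (a := (0 : ℝ)) (b := b ij.1 + b ij.2)).prod
      (isCompact_Icc (a := (0 : ℝ)) (b := L * (b ij.1 + b ij.2)))).tendsto_subseq
    (x := fun k ij => (lam k * dist (c k ij.1) (c k ij.2),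
      lam k * dist (f (c k ij.1)) (f (c k ij.2))))
    (fun k ij _ => ⟨⟨mul_nonneg (hpos k).le dist_nonneg, hd k _ _⟩,
      ⟨mul_nonneg (hpos k).le dist_nonneg, hfd k _ _⟩⟩)
  have hlimX : ∀ i j, Tendsto (fun k => (lam ∘ φ) k * dist ((c ∘ φ) k i) ((c ∘ φ) k j)) atTop
      (𝓝 (D (i, j)).1) := fun i j =>
    (continuous_fst.tendsto _).comp ((tendsto_pi_nhds.1 hD) (i, j))
  have hlimY : ∀ i j, Tendsto (fun k => (lam ∘ φ) k *
      dist (((fun k i => f (c k i)) ∘ φ) k i) (((fun k i => f (c k i)) ∘ φ) k j)) atTop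
      (𝓝 (D (i, j)).2) := fun i j =>
    (continuous_snd.tendsto _).comp ((tendsto_pi_nhds.1 hD) (i, j))
  have hposφ : ∀ k, 0 < (lam ∘ φ) k := fun k => hpos (φ k)
  have hlamφ : Tendsto (lam ∘ φ) atTop atTop := hlam.comp hφ.tendsto_atTop
  have hDbl : ∀ i j, (D (i, j)).1 / L ≤ (D (i, j)).2 ∧ (D (i, j)).2 ≤ L * (D (i, j)).1 :=
    fun i j => by
      refine ⟨le_of_tendsto_of_tendsto' ((hlimX i j).div_const L) (hlimY i j) fun k => ?_,
        le_of_tendsto_of_tendsto' (hlimY i j) ((hlimX i j).const_mul L) fun k => ?_⟩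
      · rw [mul_div_assoc]
        exact mul_le_mul_of_nonneg_left (hbl _ (hcU _ i) _ (hcU _ j)).1 (hposφ k).le
      · rw [mul_left_comm]
        exact mul_le_mul_of_nonneg_left (hbl _ (hcU _ i) _ (hcU _ j)).2 (hposφ k).le
  have hcY := (hc.image hpos hlam hxU hL hbl hV hcU).comp hφ.tendsto_atTop
  let dX := limitPseudoMetric hposφ hlimX
  let dY := limitPseudoMetric hposφ hlimY
  refine ⟨@UniformSpace.Completion _ dX.toUniformSpace, @UniformSpace.Completion _ dY.toUniformSpace,
    @UniformSpace.Completion.instMetricSpace _ dX, @UniformSpace.Completion.instMetricSpace _ dY,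
    @UniformSpace.Completion.coe' _ dX.toUniformSpace none,
    @UniformSpace.Completion.coe' _ dY.toUniformSpace none, _, ?_, ?_,
    @isBiLipschitzEquiv_completionMap _ _ dX dY (Equiv.refl _) L hL hDbl⟩
  · let := dX
    refine (hc.comp hφ.tendsto_atTop).pointedWeakTangent hposφ hlamφ (fun k => hc₀ (φ k))
      UniformSpace.Completion.denseRange_coe fun i j => ?_
    rw [UniformSpace.Completion.dist_eq]
    exact hlimX i j
  · let := dY
    refine hcY.pointedWeakTangent hposφ hlamφ (fun k => congrArg f (hc₀ (φ k)))
      UniformSpace.Completion.denseRange_coe fun i j => ?_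
    rw [UniformSpace.Completion.dist_eq]
    exact hlimY i j
end
end
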